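/- arXiv:2102.11613 — 2 statements merged into one kernel-verified Lean document; each statement's English description precedes it below -/
import Mathlib

section
/- Let (M,d,μ) be a doubling metric measure space and H_t a symmetric Markovian kernel satisfying the Chapman–Kolmogorov identity and two-sided Gaussian bounds. Let p ∈ (1,∞), q ∈ [1,∞], β ∈ ℝ, c > 0 and γ ≥ 0. Then there exists a constant C > 0 such that for every measurable function f on M with T_{γt}|f|(x) < ∞ for all t > 0 and x ∈ M one has ‖ (t,x) ↦ t^β T_{ct}(|T_{γt} f|)(x) ‖_{L^p(L^q_+)} ≤ C ‖ (t,x) ↦ t^β (T_{γt} f)(x) ‖_{L^p(L^q_+)} (with T_0 f = f when γ = 0). -/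
open MeasureTheory Metric Set

variable {M : Type*} [MetricSpace M] [MeasurableSpace M]

/-- The operator `T_t` associated with a kernel `H`, with the convention `T_0 f = f`. -/
noncomputable def Tt (μ : Measure M) (H : ℝ → M → M → ℝ) (t : ℝ) (f : M → ℝ) (x : M) : ℝ :=
  if t = 0 then f x else ∫ y, H t x y * f y ∂μ

/-- The `L^q((0,∞), dt/t)` norm of a `(0,∞)`-indexed family in `[0,∞]`,
with the supremum when `q = ∞`. -/
noncomputable def qIntNorm (q : ENNReal) (G : ℝ → ENNReal) : ENNReal :=
  if q = ⊤ then ⨆ t ∈ Ioi (0 : ℝ), G t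
  else (∫⁻ t in Ioi (0 : ℝ), G t ^ q.toReal * ENNReal.ofReal t⁻¹) ^ (1 / q.toReal)

/-- The mixed norm `‖F‖_{L^p(L^q_+)}`. -/
noncomputable def LpLqNorm (μ : Measure M) (p : ℝ) (q : ENNReal) (F : ℝ → M → ℝ) : ENNReal :=
  (∫⁻ x, qIntNorm q (fun t => ENNReal.ofReal |F t x|) ^ p ∂μ) ^ (1 / p)

section MaxErgodic

open scoped ENNReal

variable {X : Type*} [MeasurableSpace X]

/-- The integral operator with nonnegative kernel `κ`. -/
noncomputable def kop (μ : Measure X) (κ : X → X → ℝ≥0∞) (h : X → ℝ≥0∞) (x : X) : ℝ≥0∞ :=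
  ∫⁻ y, κ x y * h y ∂μ

/-- Measurable symmetric Markov kernels. -/
structure MK (μ : Measure X) (κ : X → X → ℝ≥0∞) : Prop where
  meas : Measurable (Function.uncurry κ)
  symm : ∀ x y, κ x y = κ y x
  markov : ∀ x, ∫⁻ y, κ x y ∂μ = 1

variable {μ : Measure X} {κ : X → X → ℝ≥0∞}

theorem MK.meas1 (hk : MK μ κ) (x : X) : Measurable (κ x) :=
  hk.meas.comp measurable_prodMk_left

theorem MK.meas1_mul (hk : MK μ κ) (x : X) {h : X → ℝ≥0∞} (hh : Measurable h) :
    Measurable fun y => κ x y * h y :=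
  (hk.meas1 x).mul hh

theorem MK.measurable_kop [SFinite μ] (hk : MK μ κ) {h : X → ℝ≥0∞} (hh : Measurable h) :
    Measurable (kop μ κ h) := by
  apply Measurable.lintegral_prod_right' (f := fun p : X × X => κ p.1 p.2 * h p.2)
  exact hk.meas.mul (hh.comp measurable_snd)

theorem kop_mono {g h : X → ℝ≥0∞} (hgh : ∀ x, g x ≤ h x) (x : X) :
    kop μ κ g x ≤ kop μ κ h x :=
  lintegral_mono fun y => mul_le_mul_right (hgh y) _

theorem MK.kop_add (hk : MK μ κ) {g h : X → ℝ≥0∞} (hg : Measurable g) (x : X) :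
    kop μ κ (fun y => g y + h y) x = kop μ κ g x + kop μ κ h x := by
  unfold kop
  simp only [mul_add]
  rw [lintegral_add_left (hk.meas1_mul x hg)]

theorem MK.kop_const (hk : MK μ κ) (a : ℝ≥0∞) (x : X) :
    kop μ κ (fun _ => a) x = a := by
  unfold kop
  rw [lintegral_mul_const _ (hk.meas1 x), hk.markov, one_mul]

theorem MK.kop_mul_swap [SFinite μ] (hk : MK μ κ) {g h : X → ℝ≥0∞} (hg : Measurable g)
    (hh : Measurable h) :
    ∫⁻ x, kop μ κ g x * h x ∂μ = ∫⁻ x, g x * kop μ κ h x ∂μ := by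
  have h1 : ∀ x, kop μ κ g x * h x = ∫⁻ y, κ x y * g y * h x ∂μ := fun x => by
    unfold kop
    rw [lintegral_mul_const _ (hk.meas1_mul x hg)]
  have h2 : ∀ y, g y * kop μ κ h y = ∫⁻ x, κ x y * g y * h x ∂μ := fun x => by
    unfold kop
    rw [← lintegral_const_mul _ (hk.meas1_mul x hh)]
    refine lintegral_congr fun y => ?_
    rw [hk.symm y x]; ring
  simp_rw [h1, h2]
  apply lintegral_lintegral_swap
  apply Measurable.aemeasurable
  exact (hk.meas.mul (hg.comp measurable_snd)).mul (hh.comp measurable_fst)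

theorem MK.lintegral_kop [SFinite μ] (hk : MK μ κ) {g : X → ℝ≥0∞} (hg : Measurable g) :
    ∫⁻ x, kop μ κ g x ∂μ = ∫⁻ x, g x ∂μ := by
  have := hk.kop_mul_swap hg (measurable_const (a := (1 : ℝ≥0∞)))
  simpa [hk.kop_const] using this

/-- Partial sums `∑_{k<n} P^k h`. -/
noncomputable def psum (μ : Measure X) (κ : X → X → ℝ≥0∞) (h : X → ℝ≥0∞) : ℕ → X → ℝ≥0∞
  | 0 => fun _ => 0
  | n + 1 => fun x => h x + kop μ κ (psum μ κ h n) x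

/-- Garsia's auxiliary functions. -/
noncomputable def gar (μ : Measure X) (κ : X → X → ℝ≥0∞) (h : X → ℝ≥0∞) (l : ℝ≥0∞) :
    ℕ → X → ℝ≥0∞
  | 0 => fun _ => 0
  | n + 1 => fun x => (h x + kop μ κ (gar μ κ h l n) x) - l

theorem MK.measurable_psum [SFinite μ] (hk : MK μ κ) {h : X → ℝ≥0∞} (hh : Measurable h) (n : ℕ) :
    Measurable (psum μ κ h n) := by
  induction n with
  | zero => exact measurable_const
  | succ n ih => exact hh.add (hk.measurable_kop ih)

theorem MK.measurable_gar [SFinite μ] (hk : MK μ κ) {h : X → ℝ≥0∞} (hh : Measurable h) (l : ℝ≥0∞)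
    (n : ℕ) : Measurable (gar μ κ h l n) := by
  induction n with
  | zero => exact measurable_const
  | succ n ih => exact (hh.add (hk.measurable_kop ih)).sub_const _

theorem gar_mono (h : X → ℝ≥0∞) (l : ℝ≥0∞) (n : ℕ) :
    ∀ x, gar μ κ h l n x ≤ gar μ κ h l (n + 1) x := by
  induction n with
  | zero => intro x; simp [gar]
  | succ n ih =>
    intro x
    change (h x + kop μ κ (gar μ κ h l n) x) - l ≤ (h x + kop μ κ (gar μ κ h l (n+1)) x) - l
    gcongr
    exact kop_mono ih x

theorem MK.psum_le_gar [SFinite μ] (hk : MK μ κ) {h : X → ℝ≥0∞} (hh : Measurable h) (l : ℝ≥0∞)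
    (n : ℕ) : ∀ x, psum μ κ h n x ≤ gar μ κ h l n x + n * l := by
  induction n with
  | zero => intro x; simp [psum]
  | succ n ih =>
    intro x
    change h x + kop μ κ (psum μ κ h n) x ≤ ((h x + kop μ κ (gar μ κ h l n) x) - l) + _
    have h1 : kop μ κ (psum μ κ h n) x ≤ kop μ κ (gar μ κ h l n) x + n * l := by
      calc _ ≤ _ := kop_mono ih x
        _ = _ := by rw [hk.kop_add (hk.measurable_gar hh l n), hk.kop_const]
    calc _ ≤ h x + (kop μ κ (gar μ κ h l n) x + n * l) := by gcongr
      _ = (h x + kop μ κ (gar μ κ h l n) x) + n * l := by ring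
      _ ≤ ((h x + kop μ κ (gar μ κ h l n) x) - l + l) + n * l := by
          gcongr ?_ + _; exact le_tsub_add
      _ = _ := by push_cast; ring

theorem MK.gar_lintegral [SFinite μ] (hk : MK μ κ) {h : X → ℝ≥0∞} (hh : Measurable h) (l : ℝ≥0∞)
    (hfin : ∫⁻ x, h x ∂μ ≠ ⊤) (n : ℕ) : ∫⁻ x, gar μ κ h l n x ∂μ ≠ ⊤ := by
  induction n with
  | zero => simp [gar]
  | succ n ih =>
    have : ∫⁻ x, gar μ κ h l (n+1) x ∂μ ≤ ∫⁻ x, h x + kop μ κ (gar μ κ h l n) x ∂μ :=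
      lintegral_mono fun x => tsub_le_self
    rw [lintegral_add_left hh, hk.lintegral_kop (hk.measurable_gar hh l n)] at this
    exact ne_top_of_le_ne_top (ENNReal.add_ne_top.2 ⟨hfin, ih⟩) this

/-- Hopf's maximal ergodic inequality. -/
theorem MK.weak_gar [SFinite μ] (hk : MK μ κ) {h : X → ℝ≥0∞} (hh : Measurable h) (l : ℝ≥0∞)
    (n : ℕ) : l * μ {x | 0 < gar μ κ h l n x} ≤ ∫⁻ x, h x ∂μ := by
  by_cases hfin : ∫⁻ x, h x ∂μ = ⊤
  · rw [hfin]; exact le_top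
  have hm := hk.measurable_gar hh l n
  set E := {x | 0 < gar μ κ h l n x} with hE
  have hEm : MeasurableSet E := measurableSet_lt measurable_const hm
  have h1 : ∀ x, gar μ κ h l n x + E.indicator (fun _ => l) x
      ≤ h x + kop μ κ (gar μ κ h l n) x := by
    intro x
    by_cases hx : x ∈ E
    · rw [indicator_of_mem hx]
      cases n with
      | zero => simp [hE, gar] at hx
      | succ n =>
        have hx' : 0 < (h x + kop μ κ (gar μ κ h l n) x) - l := hx
        change (h x + kop μ κ (gar μ κ h l n) x) - l + l ≤ _
        rw [tsub_add_cancel_of_le (tsub_pos_iff_lt.1 hx').le]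
        gcongr
        exact kop_mono (gar_mono h l n) x
    · rw [indicator_of_notMem hx]
      have : gar μ κ h l n x = 0 := by simpa [hE] using hx
      rw [this]; simp
  have h2 := lintegral_mono (μ := μ) h1
  rw [lintegral_add_left hm, lintegral_add_left hh, hk.lintegral_kop hm,
    lintegral_indicator_const hEm, add_comm] at h2
  exact (ENNReal.add_le_add_iff_right (hk.gar_lintegral hh l hfin n)).1 h2

theorem MK.weak_psum [SFinite μ] (hk : MK μ κ) {h : X → ℝ≥0∞} (hh : Measurable h) (l : ℝ≥0∞) :
    l * μ {x | ∃ n : ℕ, n * l < psum μ κ h n x} ≤ ∫⁻ x, h x ∂μ := by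
  have hsub : {x | ∃ n : ℕ, n * l < psum μ κ h n x} ⊆ ⋃ n, {x | 0 < gar μ κ h l n x} := by
    rintro x ⟨n, hn⟩
    rw [mem_iUnion]
    refine ⟨n, ?_⟩
    by_contra h0
    have h0' : gar μ κ h l n x = 0 := by simpa using h0
    have := hk.psum_le_gar hh l n x
    rw [h0', zero_add] at this
    exact absurd hn (not_lt.2 this)
  refine (mul_le_mul_right (measure_mono hsub) l).trans ?_
  have hmono : Monotone fun n => {x | 0 < gar μ κ h l n x} := by
    apply monotone_nat_of_le_succ
    intro n x hx
    exact lt_of_lt_of_le hx (gar_mono h l n x)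
  rw [hmono.measure_iUnion, ENNReal.mul_iSup]
  exact iSup_le fun n => hk.weak_gar hh l n

theorem MK.psum_le_add [SFinite μ] (hk : MK μ κ) {h g : X → ℝ≥0∞} (hg : Measurable g)
    (a : ℝ≥0∞) (hle : ∀ x, h x ≤ g x + a) (n : ℕ) :
    ∀ x, psum μ κ h n x ≤ psum μ κ g n x + n * a := by
  induction n with
  | zero => intro x; simp [psum]
  | succ n ih =>
    intro x
    change h x + kop μ κ (psum μ κ h n) x ≤ g x + kop μ κ (psum μ κ g n) x + _
    have h1 : kop μ κ (psum μ κ h n) x ≤ kop μ κ (psum μ κ g n) x + n * a := by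
      calc _ ≤ _ := kop_mono ih x
        _ = _ := by rw [hk.kop_add (hk.measurable_psum hg n), hk.kop_const]
    calc _ ≤ (g x + a) + (kop μ κ (psum μ κ g n) x + n * a) := by gcongr; exact hle x
      _ = _ := by push_cast; ring

/-- The ergodic maximal function. -/
noncomputable def amax (μ : Measure X) (κ : X → X → ℝ≥0∞) (h : X → ℝ≥0∞) (x : X) : ℝ≥0∞ :=
  ⨆ n : ℕ, psum μ κ h (n + 1) x / (n + 1 : ℕ)

theorem MK.measurable_amax [SFinite μ] (hk : MK μ κ) {h : X → ℝ≥0∞} (hh : Measurable h) :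
    Measurable (amax μ κ h) :=
  Measurable.iSup fun n => (hk.measurable_psum hh _).div_const _

theorem MK.weak_amax [SFinite μ] (hk : MK μ κ) {h : X → ℝ≥0∞} (hh : Measurable h)
    (l : ℝ≥0∞) :
    l * μ {x | l < amax μ κ h x} ≤ 2 * (μ.withDensity h) {x | l < 2 * h x} := by
  set S := {x | l < 2 * h x} with hS
  have hSm : MeasurableSet S := measurableSet_lt measurable_const (hh.const_mul _)
  set g := S.indicator h with hg
  have hgm : Measurable g := hh.indicator hSm
  have hle : ∀ x, h x ≤ g x + l / 2 := by
    intro x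
    by_cases hx : x ∈ S
    · rw [hg, indicator_of_mem hx]; exact le_self_add
    · rw [hg, indicator_of_notMem hx, zero_add]
      have : 2 * h x ≤ l := by simpa [hS] using hx
      rw [ENNReal.le_div_iff_mul_le (by simp) (by simp), mul_comm]
      exact this
  have hsub : {x | l < amax μ κ h x} ⊆ {x | ∃ n : ℕ, n * (l / 2) < psum μ κ g n x} := by
    intro x hx
    have hx' : l < ⨆ n : ℕ, psum μ κ h (n + 1) x / (n + 1 : ℕ) := hx
    obtain ⟨n, hn⟩ := lt_iSup_iff.1 hx'
    refine ⟨n + 1, ?_⟩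
    rw [ENNReal.lt_div_iff_mul_lt (by simp) (by simp)] at hn
    have h2 := hk.psum_le_add hgm _ hle (n + 1) x
    have h3 := lt_of_lt_of_le hn h2
    have h4 : l * ((n + 1 : ℕ) : ℝ≥0∞) = (n + 1 : ℕ) * (l / 2) + (n + 1 : ℕ) * (l / 2) := by
      rw [← mul_add, ENNReal.add_halves, mul_comm]
    rw [h4] at h3
    exact lt_of_add_lt_add_right h3
  have h5 := hk.weak_psum hgm (l / 2)
  rw [withDensity_apply _ hSm, ← lintegral_indicator hSm]
  calc l * μ {x | l < amax μ κ h x} ≤ l * μ {x | ∃ n : ℕ, n * (l / 2) < psum μ κ g n x} :=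
        mul_le_mul_right (measure_mono hsub) l
    _ = 2 * (l / 2 * μ {x | ∃ n : ℕ, n * (l / 2) < psum μ κ g n x}) := by
        rw [← mul_assoc, ENNReal.mul_div_cancel (by simp) (by simp)]
    _ ≤ _ := by gcongr

theorem MK.strong_amax_trunc [SFinite μ] (hk : MK μ κ) {h : X → ℝ≥0∞} (hh : Measurable h)
    {r : ℝ} (hr : 1 < r) (N : ℕ) :
    ∫⁻ x, (min (amax μ κ h x) N) ^ r ∂μ ≤
      ENNReal.ofReal r * (2 * (ENNReal.ofReal (r - 1))⁻¹ * 2 ^ (r - 1)) * ∫⁻ x, h x ^ r ∂μ := by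
  have hr0 : 0 < r := by linarith
  by_cases hfin : ∫⁻ x, h x ^ r ∂μ = ⊤
  · rw [hfin, ENNReal.mul_top]
    · exact le_top
    · refine mul_ne_zero (by simpa using hr0) (mul_ne_zero (mul_ne_zero (by simp) ?_) ?_)
      · exact ENNReal.inv_ne_zero.2 ENNReal.ofReal_ne_top
      · simp
  have hhfin : ∀ᵐ x ∂μ, h x < ⊤ := by
    filter_upwards [ae_lt_top (hh.pow_const r) hfin] with x hx
    by_contra h0
    rw [not_lt, top_le_iff] at h0
    rw [h0, ENNReal.top_rpow_of_pos hr0] at hx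
    exact lt_irrefl _ hx
  set ν := μ.withDensity h with hν
  have hac : ν ≪ μ := withDensity_absolutelyContinuous _ _
  have hhfin' : ∀ᵐ x ∂ν, h x < ⊤ := hac.ae_le hhfin
  set F : X → ℝ := fun x => (min (amax μ κ h x) N).toReal with hF
  have hFm : Measurable F := ((hk.measurable_amax hh).min measurable_const).ennreal_toReal
  set G : X → ℝ := fun x => (2 * h x).toReal with hG
  have hGm : Measurable G := (hh.const_mul _).ennreal_toReal
  have hminfin : ∀ x, min (amax μ κ h x) (N : ℝ≥0∞) ≠ ⊤ := fun x =>
    ne_top_of_le_ne_top (by simp) (min_le_right _ _)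
  have e1 : ∫⁻ x, (min (amax μ κ h x) N) ^ r ∂μ = ∫⁻ x, ENNReal.ofReal (F x ^ r) ∂μ := by
    refine lintegral_congr fun x => ?_
    rw [← ENNReal.ofReal_rpow_of_nonneg ENNReal.toReal_nonneg hr0.le,
      ENNReal.ofReal_toReal (hminfin x)]
  have e2 := lintegral_rpow_eq_lintegral_meas_lt_mul μ (f := F)
    (ae_of_all _ fun x => ENNReal.toReal_nonneg) hFm.aemeasurable hr0
  have e3 := lintegral_rpow_eq_lintegral_meas_lt_mul ν (f := G)
    (ae_of_all _ fun x => ENNReal.toReal_nonneg) hGm.aemeasurable (p := r - 1) (by linarith)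
  have e4 : ∫⁻ x, ENNReal.ofReal (G x ^ (r - 1)) ∂ν = 2 ^ (r - 1) * ∫⁻ x, h x ^ r ∂μ := by
    have : ∫⁻ x, ENNReal.ofReal (G x ^ (r - 1)) ∂ν = ∫⁻ x, (2 * h x) ^ (r - 1) ∂ν := by
      refine lintegral_congr_ae ?_
      filter_upwards [hhfin'] with x hx
      rw [← ENNReal.ofReal_rpow_of_nonneg ENNReal.toReal_nonneg (by linarith),
        ENNReal.ofReal_toReal (ENNReal.mul_ne_top (by simp) hx.ne)]
    rw [this, hν, lintegral_withDensity_eq_lintegral_mul _ hh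
      ((hh.const_mul _).pow_const _), ← lintegral_const_mul _ (hh.pow_const r)]
    refine lintegral_congr fun x => ?_
    simp only [Pi.mul_apply]
    rw [ENNReal.mul_rpow_of_nonneg _ _ (by linarith)]
    have h1 : h x ^ r = h x * h x ^ (r - 1) := by
      have := ENNReal.rpow_add_of_nonneg (x := h x) 1 (r - 1) (by simp) (by linarith)
      simpa using this
    rw [h1]; ring
  have e5 : ∫⁻ t in Ioi (0 : ℝ), μ {a | t < F a} * ENNReal.ofReal (t ^ (r - 1)) ≤
      ∫⁻ t in Ioi (0 : ℝ), 2 * (ν {a | t < G a} * ENNReal.ofReal (t ^ (r - 1 - 1))) := by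
    refine setLIntegral_mono' measurableSet_Ioi fun t ht => ?_
    have ht' : 0 < t := ht
    have h1 : {a | t < F a} ⊆ {a | ENNReal.ofReal t < amax μ κ h a} := by
      intro a ha
      have ha' : t < (min (amax μ κ h a) N).toReal := ha
      have := (ENNReal.ofReal_lt_iff_lt_toReal ht'.le (hminfin a)).2 ha'
      exact lt_of_lt_of_le this (min_le_left _ _)
    have h2 : ν {a | ENNReal.ofReal t < 2 * h a} ≤ ν {a | t < G a} := by
      refine measure_mono_ae ?_
      filter_upwards [hhfin'] with a ha hlt
      exact (ENNReal.ofReal_lt_iff_lt_toReal ht'.le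
        (ENNReal.mul_ne_top (by simp) ha.ne)).1 hlt
    have h3 := hk.weak_amax hh (ENNReal.ofReal t)
    have h4 : t ^ (r - 1) = t * t ^ (r - 1 - 1) := by
      rw [Real.rpow_sub_one ht'.ne' (r - 1)]; field_simp
    rw [h4, ENNReal.ofReal_mul ht'.le]
    calc _ ≤ μ {a | ENNReal.ofReal t < amax μ κ h a} *
          (ENNReal.ofReal t * ENNReal.ofReal (t ^ (r - 1 - 1))) := by gcongr
      _ = (ENNReal.ofReal t * μ {a | ENNReal.ofReal t < amax μ κ h a}) *
          ENNReal.ofReal (t ^ (r - 1 - 1)) := by ring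
      _ ≤ (2 * ν {a | ENNReal.ofReal t < 2 * h a}) * ENNReal.ofReal (t ^ (r - 1 - 1)) := by gcongr
      _ ≤ (2 * ν {a | t < G a}) * ENNReal.ofReal (t ^ (r - 1 - 1)) := by gcongr
      _ = _ := by ring
  rw [lintegral_const_mul' _ _ (by simp)] at e5
  rw [e4] at e3
  have e6 : ∫⁻ t in Ioi (0 : ℝ), ν {a | t < G a} * ENNReal.ofReal (t ^ (r - 1 - 1)) =
      (ENNReal.ofReal (r - 1))⁻¹ * (2 ^ (r - 1) * ∫⁻ x, h x ^ r ∂μ) := by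
    rw [e3, ← mul_assoc, ENNReal.inv_mul_cancel, one_mul]
    · simp; linarith
    · simp
  rw [e6] at e5
  rw [e1, e2]
  calc _ ≤ ENNReal.ofReal r * (2 * ((ENNReal.ofReal (r - 1))⁻¹ *
        (2 ^ (r - 1) * ∫⁻ x, h x ^ r ∂μ))) := by gcongr
    _ = _ := by ring

theorem iSup_min_nat (a : ℝ≥0∞) : ⨆ N : ℕ, min a (N : ℝ≥0∞) = a := by
  apply le_antisymm
  · exact iSup_le fun N => min_le_left _ _
  · refine le_of_forall_lt fun b hb => ?_
    obtain ⟨n, hn⟩ := ENNReal.exists_nat_gt hb.ne_top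
    exact lt_of_lt_of_le (lt_min hb hn) (le_iSup (fun N : ℕ => min a (N : ℝ≥0∞)) n)

theorem MK.strong_amax [SFinite μ] (hk : MK μ κ) {h : X → ℝ≥0∞} (hh : Measurable h)
    {r : ℝ} (hr : 1 < r) :
    ∫⁻ x, (amax μ κ h x) ^ r ∂μ ≤
      ENNReal.ofReal r * (2 * (ENNReal.ofReal (r - 1))⁻¹ * 2 ^ (r - 1)) * ∫⁻ x, h x ^ r ∂μ := by
  have hr0 : 0 < r := by linarith
  have : ∀ x, amax μ κ h x ^ r = ⨆ N : ℕ, (min (amax μ κ h x) N) ^ r := by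
    intro x
    conv_lhs => rw [← iSup_min_nat (amax μ κ h x)]
    exact (ENNReal.orderIsoRpow r hr0).map_iSup _
  simp_rw [this]
  rw [lintegral_iSup]
  · exact iSup_le fun N => hk.strong_amax_trunc hh hr N
  · exact fun N => ((hk.measurable_amax hh).min measurable_const).pow_const _
  · intro a b hab x
    exact ENNReal.rpow_le_rpow (min_le_min le_rfl (by exact_mod_cast hab)) hr0.le

end MaxErgodic
section SemigroupMax

open scoped ENNReal

variable {X : Type*} [MeasurableSpace X]

/-- Symmetric Markov semigroup kernels satisfying a time comparison. -/
structure SG (μ : Measure X) (k : ℝ → X → X → ℝ≥0∞) : Prop where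
  meas : Measurable fun p : ℝ × X × X => k p.1 p.2.1 p.2.2
  symm : ∀ t x y, 0 < t → k t x y = k t y x
  markov : ∀ t x, 0 < t → ∫⁻ y, k t x y ∂μ = 1
  ck : ∀ s t x y, 0 < s → 0 < t → ∫⁻ z, k s x z * k t z y ∂μ = k (s + t) x y
  comp : ∃ K : ℝ, 1 ≤ K ∧ ∀ L : ℝ, ∃ C : ℝ≥0∞, C ≠ ⊤ ∧ ∀ t s, 0 < t → K * t ≤ s → s ≤ L * t →
    ∀ x y, k t x y ≤ C * k s x y

variable {μ : Measure X} {k : ℝ → X → X → ℝ≥0∞}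

theorem SG.mk' (hk : SG μ k) {t : ℝ} (ht : 0 < t) : MK μ (k t) where
  meas := hk.meas.comp (measurable_const.prodMk (measurable_fst.prodMk measurable_snd))
  symm := fun x y => hk.symm t x y ht
  markov := fun x => hk.markov t x ht

theorem SG.kop_comp [SFinite μ] (hk : SG μ k) {s t : ℝ} (hs : 0 < s) (ht : 0 < t)
    {h : X → ℝ≥0∞} (hh : Measurable h) (x : X) :
    kop μ (k s) (kop μ (k t) h) x = kop μ (k (s + t)) h x := by
  have ms := (hk.mk' hs)
  have mt := (hk.mk' ht)
  unfold kop
  have h1 : ∀ z, k s x z * ∫⁻ y, k t z y * h y ∂μ = ∫⁻ y, k s x z * (k t z y * h y) ∂μ :=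
    fun z => (lintegral_const_mul _ (mt.meas1_mul z hh)).symm
  simp_rw [h1]
  rw [lintegral_lintegral_swap]
  · refine lintegral_congr fun y => ?_
    rw [← hk.ck s t x y hs ht, ← lintegral_mul_const]
    · simp_rw [mul_assoc]
    · exact (ms.meas1 x).mul (mt.meas.comp measurable_prodMk_right)
  · apply Measurable.aemeasurable
    exact ((ms.meas1 x).comp measurable_fst).mul (mt.meas.mul (hh.comp measurable_snd))

theorem kop_le_of_le {κ κ' : X → X → ℝ≥0∞} {C : ℝ≥0∞} (hC : C ≠ ⊤)
    (hle : ∀ x y, κ x y ≤ C * κ' x y) (h : X → ℝ≥0∞) (x : X) :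
    kop μ κ h x ≤ C * kop μ κ' h x := by
  unfold kop
  rw [← lintegral_const_mul' _ _ hC]
  refine lintegral_mono fun y => ?_
  calc _ ≤ (C * κ' x y) * h y := by gcongr; exact hle x y
    _ = _ := by ring

theorem MK.kop_finset_sum [SFinite μ] {κ : X → X → ℝ≥0∞} (hk : MK μ κ) (n : ℕ)
    (g : ℕ → X → ℝ≥0∞)
    (hg : ∀ i, Measurable (g i)) (x : X) :
    kop μ κ (fun y => ∑ i ∈ Finset.range n, g i y) x =
      ∑ i ∈ Finset.range n, kop μ κ (g i) x := by
  unfold kop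
  simp_rw [Finset.mul_sum]
  rw [lintegral_finsetSum]
  exact fun i _ => hk.meas1_mul x (hg i)

theorem SG.psum_eq [SFinite μ] (hk : SG μ k) {δ : ℝ} (hδ : 0 < δ) {h : X → ℝ≥0∞}
    (hh : Measurable h) (n : ℕ) :
    ∀ x, psum μ (k δ) h n x =
      ∑ j ∈ Finset.range n, (if j = 0 then h x else kop μ (k (j * δ)) h x) := by
  induction n with
  | zero => intro x; simp [psum]
  | succ n ih =>
    intro x
    rw [Finset.sum_range_succ']
    change h x + kop μ (k δ) (psum μ (k δ) h n) x = _
    rw [funext ih, (hk.mk' hδ).kop_finset_sum]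
    · simp only [if_true, Nat.succ_ne_zero, if_false]
      rw [add_comm]
      congr 1
      refine Finset.sum_congr rfl fun j _ => ?_
      by_cases hj : j = 0
      · subst hj; simp
      · simp only [hj, if_false]
        have hj0 : (0 : ℝ) < j := by exact_mod_cast Nat.pos_of_ne_zero hj
        have := hk.kop_comp hδ (mul_pos hj0 hδ) hh x
        refine Eq.trans this ?_
        congr 2
        push_cast; ring
    · intro j
      by_cases hj : j = 0
      · simp only [hj, if_true]; exact hh
      · simp only [hj, if_false]
        have hj0 : (0 : ℝ) < j := by exact_mod_cast Nat.pos_of_ne_zero hj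
        exact (hk.mk' (mul_pos hj0 hδ)).measurable_kop hh

theorem SG.dom [SFinite μ] (hk : SG μ k) : ∃ C : ℝ≥0∞, C ≠ ⊤ ∧ ∀ δ t, 0 < δ → δ ≤ t →
    ∀ h : X → ℝ≥0∞, Measurable h → ∀ x, kop μ (k t) h x ≤ C * amax μ (k δ) h x := by
  obtain ⟨K, hK, hcomp⟩ := hk.comp
  obtain ⟨C, hC, hc⟩ := hcomp (4 * K)
  refine ⟨2 * C, ENNReal.mul_ne_top (by simp) hC, fun δ t hδ hδt h hh x => ?_⟩
  have ht : 0 < t := lt_of_lt_of_le hδ hδt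
  set m := ⌈K * t / δ⌉₊ with hm
  have hpos : 0 < K * t / δ := by positivity
  have hm1 : 0 < m := Nat.ceil_pos.2 hpos
  have hle : K * t ≤ m * δ := by
    have := Nat.le_ceil (K * t / δ)
    rwa [div_le_iff₀ hδ] at this
  have hge : m * δ ≤ 2 * (K * t) := by
    have h1 := (Nat.ceil_lt_add_one hpos.le).le
    have h2 : (m : ℝ) * δ ≤ (K * t / δ + 1) * δ := by gcongr
    have h3 : (K * t / δ + 1) * δ = K * t + δ := by field_simp
    nlinarith
  have h1 : ∀ j ∈ Finset.Ico m (2 * m), kop μ (k t) h x ≤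
      C * (if j = 0 then h x else kop μ (k (j * δ)) h x) := by
    intro j hj
    rw [Finset.mem_Ico] at hj
    have hj0 : j ≠ 0 := by omega
    simp only [hj0, if_false]
    apply kop_le_of_le hC
    apply hc t _ ht
    · refine hle.trans ?_
      gcongr
      exact hj.1
    · have : (j : ℝ) * δ ≤ (2 * m : ℕ) * δ := by
        gcongr
        exact hj.2.le
      push_cast at this
      linarith
  have h2 : (m : ℝ≥0∞) * kop μ (k t) h x ≤ C * psum μ (k δ) h (2 * m) x := by
    have h3 := Finset.sum_le_sum h1
    rw [Finset.sum_const, Nat.card_Ico, show 2 * m - m = m by omega, nsmul_eq_mul,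
      ← Finset.mul_sum] at h3
    refine h3.trans ?_
    rw [hk.psum_eq hδ hh]
    gcongr
    intro j hj
    rw [Finset.mem_Ico] at hj
    exact Finset.mem_range.2 hj.2
  have h4 : psum μ (k δ) h (2 * m) x ≤ (2 * m : ℕ) * amax μ (k δ) h x := by
    have h5 := le_iSup (fun n : ℕ => psum μ (k δ) h (n + 1) x / (n + 1 : ℕ)) (2 * m - 1)
    rw [show 2 * m - 1 + 1 = 2 * m by omega] at h5
    change _ ≤ amax μ (k δ) h x at h5
    rw [ENNReal.div_le_iff_le_mul] at h5
    · exact h5.trans_eq (mul_comm _ _)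
    · left; simp; omega
    · left; exact ENNReal.natCast_ne_top _
  have hm0 : (m : ℝ≥0∞) ≠ 0 := by simp; omega
  have h6 : (m : ℝ≥0∞) * kop μ (k t) h x ≤ m * (2 * C * amax μ (k δ) h x) := by
    calc _ ≤ _ := h2
      _ ≤ C * ((2 * m : ℕ) * amax μ (k δ) h x) := by gcongr
      _ = _ := by push_cast; ring
  exact (ENNReal.mul_le_mul_iff_right hm0 (by simp)).1 h6

theorem SG.maximal [SFinite μ] (hk : SG μ k) : ∃ Mx : (X → ℝ≥0∞) → X → ℝ≥0∞,
    (∀ h, Measurable h → Measurable (Mx h)) ∧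
    (∀ h, Measurable h → ∀ t, 0 < t → ∀ x, kop μ (k t) h x ≤ Mx h x) ∧
    ∀ r : ℝ, 1 < r → ∃ C : ℝ≥0∞, C ≠ ⊤ ∧ ∀ h, Measurable h →
      ∫⁻ x, Mx h x ^ r ∂μ ≤ C * ∫⁻ x, h x ^ r ∂μ := by
  obtain ⟨C, hC, hdom⟩ := hk.dom
  have hδ : ∀ j : ℕ, (0 : ℝ) < (1 / 2) ^ j := fun j => by positivity
  have hmeas : ∀ h, Measurable h → ∀ j : ℕ, Measurable (amax μ (k ((1 / 2) ^ j)) h) :=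
    fun h hh j => (hk.mk' (hδ j)).measurable_amax hh
  refine ⟨fun h x => C * Filter.liminf (fun j : ℕ => amax μ (k ((1 / 2) ^ j)) h x) Filter.atTop,
    ?_, ?_, ?_⟩
  · intro h hh
    exact (Measurable.liminf (hmeas h hh)).const_mul _
  · intro h hh t ht x
    have htend : Filter.Tendsto (fun j : ℕ => ((1 : ℝ) / 2) ^ j) Filter.atTop (nhds 0) :=
      tendsto_pow_atTop_nhds_zero_of_lt_one (by norm_num) (by norm_num)
    have hev : ∀ᶠ j : ℕ in Filter.atTop, ((1 : ℝ) / 2) ^ j ≤ t :=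
      (htend.eventually (gt_mem_nhds ht)).mono fun j hj => le_of_lt hj
    have h1 : ∀ᶠ j : ℕ in Filter.atTop,
        kop μ (k t) h x / C ≤ amax μ (k ((1 / 2) ^ j)) h x := by
      filter_upwards [hev] with j hj
      exact ENNReal.div_le_of_le_mul' (hdom _ t (hδ j) hj h hh x)
    have h2 := Filter.le_liminf_of_le (by isBoundedDefault) h1
    have h3 : kop μ (k t) h x ≤ C * (kop μ (k t) h x / C) := by
      by_cases hC0 : C = 0
      · obtain ⟨j, hj⟩ := hev.exists
        have := hdom _ t (hδ j) hj h hh x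
        rw [hC0, zero_mul] at this
        exact this.trans bot_le
      · rw [ENNReal.mul_div_cancel hC0 hC]
    exact h3.trans (mul_le_mul_right h2 C)
  · intro r hr
    have hr0 : 0 < r := by linarith
    refine ⟨C ^ r * (ENNReal.ofReal r * (2 * (ENNReal.ofReal (r - 1))⁻¹ * 2 ^ (r - 1))), ?_, ?_⟩
    · refine ENNReal.mul_ne_top (ENNReal.rpow_ne_top_of_nonneg hr0.le hC)
        (ENNReal.mul_ne_top ENNReal.ofReal_ne_top (ENNReal.mul_ne_top (ENNReal.mul_ne_top
        (by simp) ?_) (ENNReal.rpow_ne_top_of_nonneg (by linarith) (by simp))))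
      rw [ENNReal.inv_ne_top]
      simpa using hr
    · intro h hh
      have h1 : ∀ x, (C * Filter.liminf (fun j : ℕ => amax μ (k ((1 / 2) ^ j)) h x)
          Filter.atTop) ^ r = C ^ r * Filter.liminf (fun j : ℕ =>
            (amax μ (k ((1 / 2) ^ j)) h x) ^ r) Filter.atTop := by
        intro x
        rw [ENNReal.mul_rpow_of_nonneg _ _ hr0.le]
        congr 1
        exact (ENNReal.orderIsoRpow r hr0).liminf_apply
      simp_rw [h1]
      rw [lintegral_const_mul' _ _ (ENNReal.rpow_ne_top_of_nonneg hr0.le hC), mul_assoc]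
      gcongr
      refine (lintegral_liminf_le fun j => (hmeas h hh j).pow_const r).trans ?_
      refine Filter.liminf_le_of_frequently_le' ?_
      exact Filter.Frequently.of_forall fun j => (hk.mk' (hδ j)).strong_amax hh hr

end SemigroupMax
section Mixed

open scoped ENNReal

variable {X : Type*} [MeasurableSpace X]

/-- Converse of Hölder's inequality. -/
theorem converse_holder {μ : Measure X} [SigmaFinite μ] {r r' : ℝ} (hr : r.HolderConjugate r')
    {Φ : X → ℝ≥0∞} (hΦ : Measurable Φ) {B : ℝ≥0∞}
    (hB : ∀ h : X → ℝ≥0∞, Measurable h →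
      ∫⁻ x, Φ x * h x ∂μ ≤ B * (∫⁻ x, h x ^ r' ∂μ) ^ (1 / r')) :
    ∫⁻ x, Φ x ^ r ∂μ ≤ B ^ r := by
  have hr0 : 0 < r := hr.pos
  have hr1 : 1 < r := hr.lt
  have hr'0 : 0 < r' := hr.symm.pos
  set S := spanningSets μ with hS
  set Ψ : ℕ → X → ℝ≥0∞ := fun n => (S n).indicator fun x => min (Φ x) n with hΨ
  have hΨm : ∀ n, Measurable (Ψ n) := fun n =>
    (hΦ.min measurable_const).indicator (measurableSet_spanningSets μ n)
  have hle : ∀ n x, Ψ n x ≤ Φ x := fun n x =>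
    (indicator_le_self' (fun _ _ => zero_le) x).trans (min_le_left _ _)
  have hlen : ∀ n x, Ψ n x ≤ n := fun n x =>
    (indicator_le_self' (fun _ _ => zero_le) x).trans (min_le_right _ _)
  have hmono : Monotone Ψ := by
    intro a b hab x
    simp only [hΨ]
    by_cases hx : x ∈ S a
    · rw [indicator_of_mem hx, indicator_of_mem (monotone_spanningSets μ hab hx)]
      exact min_le_min le_rfl (by exact_mod_cast hab)
    · rw [indicator_of_notMem hx]; exact zero_le
  have hsup : ∀ x, Φ x = ⨆ n, Ψ n x := by
    intro x
    apply le_antisymm _ (iSup_le fun n => hle n x)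
    conv_lhs => rw [← iSup_min_nat (Φ x)]
    refine iSup_le fun N => ?_
    obtain ⟨m, hm⟩ := mem_iUnion.1 (by rw [iUnion_spanningSets]; trivial : x ∈ ⋃ n, S n)
    refine le_trans ?_ (le_iSup (fun n => Ψ n x) (max N m))
    simp only [hΨ]
    rw [indicator_of_mem (monotone_spanningSets μ (le_max_right N m) hm)]
    exact min_le_min le_rfl (by exact_mod_cast le_max_left N m)
  have hbound : ∀ n, ∫⁻ x, Ψ n x ^ r ∂μ ≤ B ^ r := by
    intro n
    set I := ∫⁻ x, Ψ n x ^ r ∂μ with hI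
    have hIfin : I ≠ ⊤ := by
      have : I ≤ ∫⁻ x, (S n).indicator (fun _ => (n : ℝ≥0∞) ^ r) x ∂μ := by
        refine lintegral_mono fun x => ?_
        by_cases hx : x ∈ S n
        · rw [indicator_of_mem hx]
          exact ENNReal.rpow_le_rpow (hlen n x) hr0.le
        · simp only [hΨ]
          rw [indicator_of_notMem hx, indicator_of_notMem hx, ENNReal.zero_rpow_of_pos hr0]
      rw [lintegral_indicator_const (measurableSet_spanningSets μ n)] at this
      refine ne_top_of_le_ne_top (ENNReal.mul_ne_top ?_ ?_) this
      · exact ENNReal.rpow_ne_top_of_nonneg hr0.le (by simp)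
      · exact (measure_spanningSets_lt_top μ n).ne
    have h1 := hB (fun x => Ψ n x ^ (r - 1)) ((hΨm n).pow_const _)
    have h2 : I ≤ ∫⁻ x, Φ x * Ψ n x ^ (r - 1) ∂μ := by
      refine lintegral_mono fun x => ?_
      have h3 : Ψ n x ^ r = Ψ n x * Ψ n x ^ (r - 1) := by
        have := ENNReal.rpow_add_of_nonneg (x := Ψ n x) 1 (r - 1) (by simp) (by linarith)
        simpa using this
      simp only [h3]
      gcongr
      exact hle n x
    have h4 : ∀ x, (Ψ n x ^ (r - 1)) ^ r' = Ψ n x ^ r := by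
      intro x
      rw [← ENNReal.rpow_mul, hr.sub_one_mul_conj]
    simp_rw [h4] at h1
    have h5 : I ≤ B * I ^ (1 / r') := h2.trans h1
    by_cases hI0 : I = 0
    · rw [hI0]; exact zero_le
    have h6 : I = I ^ (1 / r) * I ^ (1 / r') := by
      rw [← ENNReal.rpow_add _ _ hI0 hIfin]
      have : 1 / r + 1 / r' = 1 := by simpa using hr.inv_add_inv_eq_one
      rw [this, ENNReal.rpow_one]
    have h7 : I ^ (1 / r) ≤ B := by
      rw [h6] at h5
      have hne0 : I ^ (1 / r') ≠ 0 := by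
        simp [ENNReal.rpow_eq_zero_iff, hI0, hIfin]
      have hnet : I ^ (1 / r') ≠ ⊤ := ENNReal.rpow_ne_top_of_nonneg (by positivity) hIfin
      have h5' : I ^ (1 / r) * I ^ (1 / r') ≤ B * I ^ (1 / r') := by
        rw [← h6] at h5 ⊢
        exact h5
      exact (ENNReal.mul_le_mul_iff_left hne0 hnet).1 h5'
    calc I = (I ^ (1 / r)) ^ r := by
          rw [← ENNReal.rpow_mul, one_div, inv_mul_cancel₀ hr0.ne', ENNReal.rpow_one]
      _ ≤ B ^ r := ENNReal.rpow_le_rpow h7 hr0.le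
  have hfin : ∀ x, Φ x ^ r = ⨆ n, Ψ n x ^ r := by
    intro x
    rw [hsup x]
    exact (ENNReal.orderIsoRpow r hr0).map_iSup _
  simp_rw [hfin]
  rw [lintegral_iSup]
  · exact iSup_le hbound
  · exact fun n => (hΨm n).pow_const _
  · intro a b hab x
    exact ENNReal.rpow_le_rpow (hmono hab x) hr0.le

variable {μ : Measure X} {k : ℝ → X → X → ℝ≥0∞}

theorem SG.measurable_joint [SFinite μ] (hk : SG μ k) (c : ℝ) {G : ℝ → X → ℝ≥0∞}
    (hG : Measurable (Function.uncurry G)) :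
    Measurable (Function.uncurry fun t x => kop μ (k (c * t)) (G t) x) := by
  apply Measurable.lintegral_prod_right'
    (f := fun p : (ℝ × X) × X => k (c * p.1.1) p.1.2 p.2 * G p.1.1 p.2)
  refine Measurable.mul ?_ ?_
  · exact hk.meas.comp (((measurable_fst.comp measurable_fst).const_mul c).prodMk
      ((measurable_snd.comp measurable_fst).prodMk measurable_snd))
  · exact hG.comp ((measurable_fst.comp measurable_fst).prodMk measurable_snd)

theorem SG.integral_avg [SFinite μ] (hk : SG μ k) {c : ℝ} (hc : 0 < c) {ν : Measure ℝ} [SFinite ν]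
    (hν : ∀ᵐ t ∂ν, 0 < t) {G : ℝ → X → ℝ≥0∞} (hG : Measurable (Function.uncurry G)) :
    ∫⁻ x, ∫⁻ t, kop μ (k (c * t)) (G t) x ∂ν ∂μ = ∫⁻ x, ∫⁻ t, G t x ∂ν ∂μ := by
  have e1 : ∫⁻ x, ∫⁻ t, G t x ∂ν ∂μ = ∫⁻ t, ∫⁻ x, G t x ∂μ ∂ν :=
    lintegral_lintegral_swap (f := fun x t => G t x) (hG.comp measurable_swap).aemeasurable
  have e2 : ∫⁻ x, ∫⁻ t, kop μ (k (c * t)) (G t) x ∂ν ∂μ =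
      ∫⁻ t, ∫⁻ x, kop μ (k (c * t)) (G t) x ∂μ ∂ν :=
    lintegral_lintegral_swap (f := fun x t => kop μ (k (c * t)) (G t) x)
      ((hk.measurable_joint c hG).comp measurable_swap).aemeasurable
  rw [e1, e2]
  refine lintegral_congr_ae ?_
  filter_upwards [hν] with t ht
  exact (hk.mk' (mul_pos hc ht)).lintegral_kop (hG.comp measurable_prodMk_left)

theorem SG.lr_avg [SigmaFinite μ] (hk : SG μ k) {c : ℝ} (hc : 0 < c) {r : ℝ} (hr : 1 < r) :
    ∃ C : ℝ≥0∞, C ≠ ⊤ ∧ ∀ (ν : Measure ℝ) [SFinite ν], (∀ᵐ t ∂ν, 0 < t) →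
      ∀ G : ℝ → X → ℝ≥0∞, Measurable (Function.uncurry G) →
      ∫⁻ x, (∫⁻ t, kop μ (k (c * t)) (G t) x ∂ν) ^ r ∂μ ≤ C * ∫⁻ x, (∫⁻ t, G t x ∂ν) ^ r ∂μ := by
  obtain ⟨Mx, hMm, hMd, hMr⟩ := hk.maximal
  set r' := r.conjExponent with hr'
  have hrr : r.HolderConjugate r' := Real.HolderConjugate.conjExponent hr
  obtain ⟨C, hC, hCr⟩ := hMr r' hrr.symm.lt
  have hr0 : 0 < r := hrr.pos
  have hr'0 : 0 < r' := hrr.symm.pos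
  refine ⟨(C ^ (1 / r')) ^ r, ?_, ?_⟩
  · exact ENNReal.rpow_ne_top_of_nonneg hr0.le (ENNReal.rpow_ne_top_of_nonneg (by positivity) hC)
  intro ν _ hν G hG
  have hJ := hk.measurable_joint c hG
  set A : X → ℝ≥0∞ := fun x => ∫⁻ t, G t x ∂ν with hA
  have hAm : Measurable A :=
    Measurable.lintegral_prod_right' (f := fun p : X × ℝ => G p.2 p.1) (hG.comp measurable_swap)
  have hΦm : Measurable fun x => ∫⁻ t, kop μ (k (c * t)) (G t) x ∂ν :=
    Measurable.lintegral_prod_right' (f := fun p : X × ℝ => kop μ (k (c * p.2)) (G p.2) p.1)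
      (hJ.comp measurable_swap)
  have key := converse_holder (μ := μ) hrr hΦm (B := (∫⁻ x, A x ^ r ∂μ) ^ (1 / r) * C ^ (1 / r')) ?_
  · refine key.trans_eq ?_
    rw [ENNReal.mul_rpow_of_nonneg _ _ hr0.le, ← ENNReal.rpow_mul, one_div,
      inv_mul_cancel₀ hr0.ne', ENNReal.rpow_one, mul_comm]
  · intro h hh
    have e1 : ∫⁻ x, (∫⁻ t, kop μ (k (c * t)) (G t) x ∂ν) * h x ∂μ
        = ∫⁻ t, ∫⁻ x, kop μ (k (c * t)) (G t) x * h x ∂μ ∂ν := by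
      rw [lintegral_lintegral_swap]
      · refine lintegral_congr fun x => ?_
        rw [lintegral_mul_const]
        exact hJ.comp measurable_prodMk_right
      · exact (hJ.mul (hh.comp measurable_snd)).aemeasurable
    have e2 : ∫⁻ t, ∫⁻ x, kop μ (k (c * t)) (G t) x * h x ∂μ ∂ν ≤
        ∫⁻ t, ∫⁻ x, G t x * Mx h x ∂μ ∂ν := by
      refine lintegral_mono_ae ?_
      filter_upwards [hν] with t ht
      have hGt : Measurable (G t) := hG.comp measurable_prodMk_left
      rw [(hk.mk' (mul_pos hc ht)).kop_mul_swap hGt hh]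
      refine lintegral_mono fun x => ?_
      gcongr
      exact hMd h hh _ (mul_pos hc ht) x
    have e3 : ∫⁻ t, ∫⁻ x, G t x * Mx h x ∂μ ∂ν = ∫⁻ x, A x * Mx h x ∂μ := by
      rw [lintegral_lintegral_swap]
      · refine lintegral_congr fun x => ?_
        rw [lintegral_mul_const]
        exact hG.comp measurable_prodMk_right
      · exact (hG.mul ((hMm h hh).comp measurable_snd)).aemeasurable
    rw [e1]
    refine (e2.trans_eq e3).trans ?_
    refine (ENNReal.lintegral_mul_le_Lp_mul_Lq μ hrr hAm.aemeasurable
      (hMm h hh).aemeasurable).trans ?_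
    rw [mul_assoc]
    gcongr
    rw [← ENNReal.mul_rpow_of_nonneg _ _ (by positivity)]
    exact ENNReal.rpow_le_rpow (hCr h hh) (by positivity)

theorem MK.kop_holder {κ : X → X → ℝ≥0∞} (hk : MK μ κ) {q q' : ℝ} (hq : q'.HolderConjugate q)
    {a b : X → ℝ≥0∞} (ha : Measurable a) (hb : Measurable b) (x : X) :
    kop μ κ (fun y => a y * b y) x ^ q ≤
      kop μ κ (fun y => a y ^ q') x ^ (q - 1) * kop μ κ (fun y => b y ^ q) x := by
  have hq0 : 0 < q := hq.symm.pos
  have conv : ∀ g : X → ℝ≥0∞, Measurable g → kop μ κ g x = ∫⁻ y, g y ∂(μ.withDensity (κ x)) := by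
    intro g hg
    rw [lintegral_withDensity_eq_lintegral_mul _ (hk.meas1 x) hg]
    rfl
  rw [conv (fun y => a y * b y) (ha.mul hb), conv _ (ha.pow_const _), conv _ (hb.pow_const _)]
  have h1 := ENNReal.lintegral_mul_le_Lp_mul_Lq (μ.withDensity (κ x)) hq ha.aemeasurable
    hb.aemeasurable
  refine (ENNReal.rpow_le_rpow h1 hq0.le).trans_eq ?_
  rw [ENNReal.mul_rpow_of_nonneg _ _ hq0.le, ← ENNReal.rpow_mul, ← ENNReal.rpow_mul]
  have e1 : 1 / q' * q = q - 1 := by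
    have := hq.symm.inv_add_inv_eq_one
    have h0 : q'⁻¹ = 1 - q⁻¹ := by linarith
    rw [one_div, h0, sub_mul, inv_mul_cancel₀ hq0.ne', one_mul]
  have e2 : 1 / q * q = 1 := by field_simp
  rw [e1, e2, ENNReal.rpow_one]

theorem MK.kop_jensen {κ : X → X → ℝ≥0∞} (hk : MK μ κ) {q : ℝ} (hq : 1 ≤ q)
    {b : X → ℝ≥0∞} (hb : Measurable b) (x : X) :
    kop μ κ b x ^ q ≤ kop μ κ (fun y => b y ^ q) x := by
  rcases hq.eq_or_lt with rfl | hq1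
  · simp
  · have := hk.kop_holder (Real.HolderConjugate.conjExponent hq1).symm
      (measurable_const (a := (1 : ℝ≥0∞))) hb x
    simpa [hk.kop_const] using this

theorem SG.mixed_le [SigmaFinite μ] (hk : SG μ k) {c : ℝ} (hc : 0 < c) {p q : ℝ} (hq : 1 ≤ q)
    (hqp : q ≤ p) :
    ∃ C : ℝ≥0∞, C ≠ ⊤ ∧ ∀ (ν : Measure ℝ) [SFinite ν], (∀ᵐ t ∂ν, 0 < t) →
      ∀ u : ℝ → X → ℝ≥0∞, Measurable (Function.uncurry u) →
      ∫⁻ x, (∫⁻ t, kop μ (k (c * t)) (u t) x ^ q ∂ν) ^ (p / q) ∂μ ≤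
        C * ∫⁻ x, (∫⁻ t, u t x ^ q ∂ν) ^ (p / q) ∂μ := by
  have hq0 : 0 < q := by linarith
  have red : ∀ (ν : Measure ℝ) [SFinite ν], (∀ᵐ t ∂ν, 0 < t) →
      ∀ u : ℝ → X → ℝ≥0∞, Measurable (Function.uncurry u) →
      ∫⁻ x, (∫⁻ t, kop μ (k (c * t)) (u t) x ^ q ∂ν) ^ (p / q) ∂μ ≤
      ∫⁻ x, (∫⁻ t, kop μ (k (c * t)) (fun y => u t y ^ q) x ∂ν) ^ (p / q) ∂μ := by
    intro ν _ hν u hu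
    refine lintegral_mono fun x => ENNReal.rpow_le_rpow ?_
      (div_nonneg (by linarith) (by linarith))
    refine lintegral_mono_ae ?_
    filter_upwards [hν] with t ht
    exact (hk.mk' (mul_pos hc ht)).kop_jensen hq (hu.comp measurable_prodMk_left) x
  rcases hqp.eq_or_lt with rfl | hlt
  · refine ⟨1, by simp, fun ν _ hν u hu => (red ν hν u hu).trans ?_⟩
    rw [div_self hq0.ne']
    simp only [ENNReal.rpow_one, one_mul]
    exact (hk.integral_avg hc hν (G := fun t y => u t y ^ q) (hu.pow_const q)).le
  · obtain ⟨C, hC, h⟩ := hk.lr_avg hc (r := p / q) ((one_lt_div hq0).2 hlt)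
    exact ⟨C, hC, fun ν _ hν u hu => (red ν hν u hu).trans
      (h ν hν (fun t y => u t y ^ q) (hu.pow_const q))⟩

theorem SG.mixed_gt [SigmaFinite μ] (hk : SG μ k) {c : ℝ} (hc : 0 < c) {p q : ℝ} (hp : 1 < p)
    (hpq : p < q) :
    ∃ C : ℝ≥0∞, C ≠ ⊤ ∧ ∀ (ν : Measure ℝ) [SFinite ν], (∀ᵐ t ∂ν, 0 < t) →
      ∀ u : ℝ → X → ℝ≥0∞, Measurable (Function.uncurry u) →
      ∫⁻ x, (∫⁻ t, kop μ (k (c * t)) (u t) x ^ q ∂ν) ^ (p / q) ∂μ ≤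
        C * ∫⁻ x, (∫⁻ t, u t x ^ q ∂ν) ^ (p / q) ∂μ := by
  obtain ⟨Mx, hMm, hMd, hMr⟩ := hk.maximal
  have hq1 : 1 < q := hp.trans hpq
  have hq0 : 0 < q := by linarith
  have hp0 : 0 < p := by linarith
  set θ := p / q with hθ
  have hθ0 : 0 < θ := by positivity
  have hθ1 : θ < 1 := (div_lt_one hq0).2 hpq
  have hθq : θ * q = p := by rw [hθ]; field_simp
  have hqq : q.conjExponent.HolderConjugate q := (Real.HolderConjugate.conjExponent hq1).symm
  set q' := q.conjExponent with hq'
  set r := (q - 1) * θ * (1 - θ)⁻¹ with hr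
  have h1θ : 0 < 1 - θ := by linarith
  have hr1 : 1 < r := by
    rw [hr, ← div_eq_mul_inv, one_lt_div h1θ]
    nlinarith
  obtain ⟨C, hC, hCr⟩ := hMr r hr1
  refine ⟨C ^ (1 - θ) + 1, by
    simpa using ENNReal.rpow_ne_top_of_nonneg h1θ.le hC, ?_⟩
  intro ν _ hν u hu
  have hum : ∀ t, Measurable (u t) := fun t => hu.comp measurable_prodMk_left
  set I : X → ℝ≥0∞ := fun x => ∫⁻ t, u t x ^ q ∂ν with hI
  have hIm : Measurable I :=
    Measurable.lintegral_prod_right' (f := fun z : X × ℝ => u z.2 z.1 ^ q)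
      ((hu.comp measurable_swap).pow_const q)
  by_cases hfin : ∫⁻ x, I x ^ θ ∂μ = ⊤
  · rw [hfin, ENNReal.mul_top (by simp)]; exact le_top
  have hIfin : ∀ᵐ x ∂μ, I x < ⊤ := by
    filter_upwards [ae_lt_top (hIm.pow_const θ) hfin] with x hx
    by_contra h0
    rw [not_lt, top_le_iff] at h0
    rw [h0, ENNReal.top_rpow_of_pos hθ0] at hx
    exact lt_irrefl _ hx
  set w : X → ℝ≥0∞ := fun y => I y ^ ((1 - θ) / q) with hw
  have hwm : Measurable w := hIm.pow_const _
  set b : ℝ → X → ℝ≥0∞ := fun t y => u t y * I y ^ ((θ - 1) / q) with hb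
  have hbm : Measurable (Function.uncurry b) := hu.mul ((hIm.pow_const _).comp measurable_snd)
  have hbm1 : ∀ t, Measurable (b t) := fun t => hbm.comp measurable_prodMk_left
  set W : X → ℝ≥0∞ := fun y => w y ^ q' with hW
  have hWm : Measurable W := hwm.pow_const _
  have hae : ∀ᵐ t ∂ν, ∀ᵐ y ∂μ, u t y = w y * b t y := by
    rw [Measure.ae_ae_comm]
    · filter_upwards [hIfin] with y hy
      by_cases h0 : I y = 0
      · have hz : ∀ᵐ t ∂ν, u t y ^ q = 0 := by
          have := (lintegral_eq_zero_iff
            ((hu.comp (measurable_prodMk_right (y := y))).pow_const q)).1 h0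
          exact this
        filter_upwards [hz] with t ht
        have h00 : u t y = 0 := by
          rcases ENNReal.rpow_eq_zero_iff.1 ht with h | h
          · exact h.1
          · linarith [h.2]
        simp [hb, h00]
      · refine ae_of_all _ fun t => ?_
        simp only [hw, hb]
        rw [mul_comm, mul_assoc, ← ENNReal.rpow_add _ _ h0 hy.ne]
        rw [show (θ - 1) / q + (1 - θ) / q = 0 by ring]
        simp
    · exact measurableSet_eq_fun hu ((hwm.comp measurable_snd).mul hbm)
  set Ψ : X → ℝ≥0∞ := fun x => ∫⁻ t, kop μ (k (c * t)) (fun y => b t y ^ q) x ∂ν with hΨ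
  have hΨm : Measurable Ψ :=
    Measurable.lintegral_prod_right'
      (f := fun z : X × ℝ => kop μ (k (c * z.2)) (fun y => b z.2 y ^ q) z.1)
      ((hk.measurable_joint c (G := fun t y => b t y ^ q) (hbm.pow_const q)).comp measurable_swap)
  have hpt : ∀ x, (∫⁻ t, kop μ (k (c * t)) (u t) x ^ q ∂ν) ≤ Mx W x ^ (q - 1) * Ψ x := by
    intro x
    have hm2 : Measurable fun t => kop μ (k (c * t)) (fun y => b t y ^ q) x :=
      (hk.measurable_joint c (G := fun t y => b t y ^ q) (hbm.pow_const q)).comp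
        (measurable_prodMk_right (y := x))
    rw [hΨ, ← lintegral_const_mul _ hm2]
    refine lintegral_mono_ae ?_
    filter_upwards [hae, hν] with t ht htpos
    have e1 : kop μ (k (c * t)) (u t) x = kop μ (k (c * t)) (fun y => w y * b t y) x := by
      unfold kop
      refine lintegral_congr_ae ?_
      filter_upwards [ht] with y hy
      rw [hy]
    have hct := mul_pos hc htpos
    rw [e1]
    refine ((hk.mk' hct).kop_holder hqq hwm (hbm1 t) x).trans ?_
    gcongr
    exact hMd W hWm _ hct x
  have hInteg : ∫⁻ x, Ψ x ∂μ = ∫⁻ x, I x ^ θ ∂μ := by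
    rw [hΨ, hk.integral_avg hc hν (G := fun t y => b t y ^ q) (hbm.pow_const q)]
    refine lintegral_congr_ae ?_
    filter_upwards [hIfin] with x hx
    have e1 : ∀ t, b t x ^ q = u t x ^ q * I x ^ (θ - 1) := by
      intro t
      simp only [hb]
      rw [ENNReal.mul_rpow_of_nonneg _ _ hq0.le, ← ENNReal.rpow_mul,
        div_mul_cancel₀ _ hq0.ne']
    simp_rw [e1]
    have hux : Measurable fun t => u t x ^ q :=
      (hu.comp (measurable_prodMk_right (y := x))).pow_const q
    rw [lintegral_mul_const _ hux]
    change I x * I x ^ (θ - 1) = _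
    by_cases h0 : I x = 0
    · rw [h0, zero_mul, ENNReal.zero_rpow_of_pos hθ0]
    · have := ENNReal.rpow_add (x := I x) 1 (θ - 1) h0 hx.ne
      rw [ENNReal.rpow_one] at this
      rw [← this]; congr 1; ring
  have hWr : ∀ x, W x ^ r = I x ^ θ := by
    intro x
    simp only [hW, hw]
    rw [← ENNReal.rpow_mul, ← ENNReal.rpow_mul]
    congr 1
    have hq'e : q' = q / (q - 1) := rfl
    rw [hq'e, hr]
    have : q - 1 ≠ 0 := by linarith
    field_simp
  have hconj : (1 - θ)⁻¹.HolderConjugate θ⁻¹ := by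
    rw [Real.holderConjugate_iff]
    refine ⟨(one_lt_inv₀ h1θ).2 (by linarith), by simp⟩
  calc ∫⁻ x, (∫⁻ t, kop μ (k (c * t)) (u t) x ^ q ∂ν) ^ θ ∂μ
      ≤ ∫⁻ x, ((fun x => Mx W x ^ ((q - 1) * θ)) * fun x => Ψ x ^ θ) x ∂μ := by
        refine lintegral_mono fun x => ?_
        refine (ENNReal.rpow_le_rpow (hpt x) hθ0.le).trans_eq ?_
        rw [ENNReal.mul_rpow_of_nonneg _ _ hθ0.le, ← ENNReal.rpow_mul]
        rfl
    _ ≤ _ := ENNReal.lintegral_mul_le_Lp_mul_Lq μ hconj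
        ((hMm W hWm).pow_const _).aemeasurable (hΨm.pow_const _).aemeasurable
    _ = (∫⁻ x, Mx W x ^ r ∂μ) ^ (1 - θ) * (∫⁻ x, Ψ x ∂μ) ^ θ := by
        simp_rw [← ENNReal.rpow_mul, mul_inv_cancel₀ hθ0.ne', ENNReal.rpow_one, one_div, inv_inv]
        rfl
    _ ≤ (C * ∫⁻ x, W x ^ r ∂μ) ^ (1 - θ) * (∫⁻ x, Ψ x ∂μ) ^ θ := by
        gcongr
        exact hCr W hWm
    _ = C ^ (1 - θ) * ∫⁻ x, I x ^ θ ∂μ := by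
        simp_rw [hWr]
        rw [hInteg, ENNReal.mul_rpow_of_nonneg _ _ h1θ.le, mul_assoc,
          ← ENNReal.rpow_add_of_nonneg _ _ h1θ.le hθ0.le]
        rw [show 1 - θ + θ = 1 by ring, ENNReal.rpow_one]
    _ ≤ _ := by gcongr; exact le_self_add

theorem SG.mixed [SigmaFinite μ] (hk : SG μ k) {c : ℝ} (hc : 0 < c) {p q : ℝ} (hp : 1 < p)
    (hq : 1 ≤ q) :
    ∃ C : ℝ≥0∞, C ≠ ⊤ ∧ ∀ (ν : Measure ℝ) [SFinite ν], (∀ᵐ t ∂ν, 0 < t) →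
      ∀ u : ℝ → X → ℝ≥0∞, Measurable (Function.uncurry u) →
      ∫⁻ x, (∫⁻ t, kop μ (k (c * t)) (u t) x ^ q ∂ν) ^ (p / q) ∂μ ≤
        C * ∫⁻ x, (∫⁻ t, u t x ^ q ∂ν) ^ (p / q) ∂μ := by
  rcases le_or_gt q p with h | h
  · exact hk.mixed_le hc hq h
  · exact hk.mixed_gt hc hp h

end Mixed
section MixedTop

open scoped ENNReal

variable {X : Type*} [MeasurableSpace X]

/-- A measurable essential supremum in the first variable. -/
theorem exists_meas_esssup {μ : Measure X} [SFinite μ] {u : ℝ → X → ℝ≥0∞}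
    (hu : Measurable (Function.uncurry u)) :
    ∃ S : X → ℝ≥0∞, Measurable S ∧ (∀ x, S x ≤ ⨆ t ∈ Ioi (0 : ℝ), u t x) ∧
      ∀ᵐ s ∂(volume.restrict (Ioi (0 : ℝ))), ∀ᵐ y ∂μ, u s y ≤ S y := by
  classical
  set ν := volume.restrict (Ioi (0 : ℝ)) with hν
  set V : ℚ → X → ℝ≥0∞ := fun a y => ν {t | ENNReal.ofReal a < u t y} with hV
  have hVm : ∀ a, Measurable (V a) := by
    intro a
    have hs : MeasurableSet {z : X × ℝ | ENNReal.ofReal a < u z.2 z.1} :=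
      measurableSet_lt measurable_const (hu.comp measurable_swap)
    exact measurable_measure_prodMk_left hs
  set S : X → ℝ≥0∞ := fun y => ⨆ a : ℚ, if 0 < V a y then ENNReal.ofReal a else 0 with hS
  have hSm : Measurable S := by
    refine Measurable.iSup fun a => Measurable.ite ?_ measurable_const measurable_const
    exact measurableSet_lt measurable_const (hVm a)
  refine ⟨S, hSm, ?_, ?_⟩
  · intro x
    refine iSup_le fun a => ?_
    split_ifs with h
    · have hne : (Ioi (0 : ℝ) ∩ {t | ENNReal.ofReal a < u t x}).Nonempty := by
        by_contra hemp
        rw [not_nonempty_iff_eq_empty] at hemp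
        have hm : MeasurableSet {t | ENNReal.ofReal a < u t x} :=
          measurableSet_lt measurable_const (hu.comp (measurable_prodMk_right (y := x)))
        have : V a x = 0 := by
          simp only [hV, hν]
          rw [Measure.restrict_apply hm, inter_comm, hemp, measure_empty]
        rw [this] at h
        exact lt_irrefl _ h
      obtain ⟨t, ht, hlt⟩ := hne
      exact hlt.le.trans (le_iSup₂ (f := fun t (_ : t ∈ Ioi (0 : ℝ)) => u t x) t ht)
    · exact zero_le
  · rw [Measure.ae_ae_comm]
    · refine ae_of_all _ fun y => ?_
      have h1 : ∀ᵐ s ∂ν, ∀ a : ℚ, ENNReal.ofReal a < u s y → 0 < V a y := by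
        rw [ae_all_iff]
        intro a
        by_cases h0 : 0 < V a y
        · exact ae_of_all _ fun s _ => h0
        · have h0' : V a y = 0 := by simpa using h0
          have h2 : ∀ᵐ s ∂ν, ¬ (ENNReal.ofReal a < u s y) := by
            rw [ae_iff]
            simpa [hV] using h0'
          filter_upwards [h2] with s hs hs'
          exact absurd hs' hs
      filter_upwards [h1] with s hs
      refine le_of_forall_lt fun b hb => ?_
      obtain ⟨a, _, ha1, ha2⟩ := ENNReal.lt_iff_exists_rat_btwn.1 hb
      change b < ENNReal.ofReal a at ha1
      change ENNReal.ofReal a < u s y at ha2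
      refine lt_of_lt_of_le ha1 ?_
      refine le_trans ?_ (le_iSup (fun a : ℚ => if 0 < V a y then ENNReal.ofReal a else 0) a)
      simp only [hs a ha2, if_true]
      exact le_rfl
    · exact measurableSet_le hu (hSm.comp measurable_snd)

variable {μ : Measure X} {k : ℝ → X → X → ℝ≥0∞}

theorem kop_const_mul {κ : X → X → ℝ≥0∞} {B : ℝ≥0∞} (hB : B ≠ ⊤) (h : X → ℝ≥0∞) (x : X) :
    kop μ κ (fun y => B * h y) x = B * kop μ κ h x := by
  unfold kop
  rw [← lintegral_const_mul' _ _ hB]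
  refine lintegral_congr fun y => ?_
  ring

theorem SG.mixed_top [SFinite μ] (hk : SG μ k) {c γ : ℝ} (hc : 0 < c) (hγ : 0 ≤ γ)
    {p : ℝ} (hp : 1 < p) {B : ℝ≥0∞} (hB : B ≠ ⊤) :
    ∃ C : ℝ≥0∞, C ≠ ⊤ ∧
      ∀ u : ℝ → X → ℝ≥0∞, Measurable (Function.uncurry u) →
      (∀ s t, 0 < s → t / 2 < s → s < t → ∀ y,
        u t y ≤ B * (if γ = 0 then u s y else kop μ (k (γ * (t - s))) (u s) y)) →
      ∫⁻ x, (⨆ t ∈ Ioi (0 : ℝ), kop μ (k (c * t)) (u t) x) ^ p ∂μ ≤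
        C * ∫⁻ x, (⨆ t ∈ Ioi (0 : ℝ), u t x) ^ p ∂μ := by
  obtain ⟨Mx, hMm, hMd, hMr⟩ := hk.maximal
  obtain ⟨K, hK, hcomp⟩ := hk.comp
  obtain ⟨C, hC, hCr⟩ := hMr p hp
  have hp0 : 0 < p := by linarith
  set L := K * (c + γ) with hL
  have hL0 : 0 < L := by positivity
  obtain ⟨C', hC', hcc⟩ := hcomp (L / c)
  refine ⟨(B * C') ^ p * C, ENNReal.mul_ne_top (ENNReal.rpow_ne_top_of_nonneg hp0.le
    (ENNReal.mul_ne_top hB hC')) hC, ?_⟩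
  intro u hu hyp
  have hum : ∀ t, Measurable (u t) := fun t => hu.comp measurable_prodMk_left
  obtain ⟨S, hSm, hSle, hSae⟩ := exists_meas_esssup (μ := μ) hu
  have key : ∀ t, 0 < t → ∀ x, kop μ (k (c * t)) (u t) x ≤ B * C' * Mx S x := by
    intro t ht x
    have hex : ∃ s, t / 2 < s ∧ s < t ∧ ∀ᵐ y ∂μ, u s y ≤ S y := by
      have h1 : ∀ᵐ s ∂(volume.restrict (Ioo (t / 2) t)), ∀ᵐ y ∂μ, u s y ≤ S y := by
        refine ae_mono (Measure.restrict_mono ?_ le_rfl) hSae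
        intro s hs
        exact lt_trans (by positivity) hs.1
      have h2 : ∀ᵐ s ∂(volume.restrict (Ioo (t / 2) t)), s ∈ Ioo (t / 2) t :=
        ae_restrict_mem measurableSet_Ioo
      have hne : (volume.restrict (Ioo (t / 2) t)) ≠ 0 := by
        rw [Ne, Measure.restrict_eq_zero, Real.volume_Ioo]
        simp; linarith
      have : (ae (volume.restrict (Ioo (t / 2) t))).NeBot := ae_neBot.2 hne
      obtain ⟨s, hs1, hs2⟩ := (h1.and h2).exists
      exact ⟨s, hs2.1, hs2.2, hs1⟩
    obtain ⟨s, hs1, hs2, hs3⟩ := hex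
    have hs0 : 0 < s := by linarith
    have hct : 0 < c * t := by positivity
    set τ := c * t + γ * (t - s) with hτ
    have hγs : 0 ≤ γ * (t - s) := mul_nonneg hγ (by linarith)
    have hτ0 : 0 < τ := by linarith
    have h1 : kop μ (k (c * t)) (u t) x ≤ B * kop μ (k τ) (u s) x := by
      refine (kop_mono (hyp s t hs0 hs1 hs2) x).trans_eq ?_
      rw [kop_const_mul hB]
      congr 1
      rcases hγ.eq_or_lt with h0 | h0
      · have : τ = c * t := by rw [hτ, ← h0]; ring
        simp only [← h0, if_true, this]
      · simp only [h0.ne', if_false]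
        exact hk.kop_comp hct (mul_pos h0 (by linarith)) (hum s) x
    have h2 : kop μ (k τ) (u s) x ≤ C' * kop μ (k (L * t)) (u s) x := by
      apply kop_le_of_le hC'
      apply hcc τ _ hτ0
      · rw [hL, mul_assoc]
        gcongr
        rw [hτ]
        nlinarith
      · rw [div_mul_eq_mul_div, le_div_iff₀ hc, mul_assoc]
        gcongr
        nlinarith
    have h3 : kop μ (k (L * t)) (u s) x ≤ kop μ (k (L * t)) S x := by
      refine lintegral_mono_ae ?_
      filter_upwards [hs3] with y hy
      gcongr
    calc _ ≤ _ := h1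
      _ ≤ B * (C' * Mx S x) := by
        gcongr
        refine h2.trans ?_
        gcongr
        exact h3.trans (hMd S hSm _ (by positivity) x)
      _ = _ := by ring
  calc _ ≤ ∫⁻ x, (B * C') ^ p * Mx S x ^ p ∂μ := by
        refine lintegral_mono fun x => ?_
        rw [← ENNReal.mul_rpow_of_nonneg _ _ hp0.le]
        exact ENNReal.rpow_le_rpow (iSup₂_le fun t ht => key t ht x) hp0.le
    _ = (B * C') ^ p * ∫⁻ x, Mx S x ^ p ∂μ := lintegral_const_mul _ ((hMm S hSm).pow_const p)
    _ ≤ (B * C') ^ p * (C * ∫⁻ x, S x ^ p ∂μ) := by gcongr; exact hCr S hSm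
    _ ≤ (B * C') ^ p * (C * ∫⁻ x, (⨆ t ∈ Ioi (0 : ℝ), u t x) ^ p ∂μ) := by
        gcongr with x
        exact hSle x
    _ = _ := by ring

end MixedTop
section Concrete

open scoped ENNReal

theorem ball_pos_of_lower {μ : Measure M} {H : ℝ → M → M → ℝ}
    {C₀ b₀ : ℝ} (hC₀ : 0 < C₀)
    (hHnonneg : ∀ t x y, 0 < t → 0 ≤ H t x y)
    (hlower : ∀ t x y, 0 < t →
      C₀⁻¹ * Real.exp (-b₀ * dist x y ^ 2 / t) ≤
        H t x y *
          Real.sqrt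
            ((μ (ball x (Real.sqrt t))).toReal * (μ (ball y (Real.sqrt t))).toReal))
    {t : ℝ} (ht : 0 < t) (x y : M) :
    0 < H t x y ∧ 0 < Real.sqrt
      ((μ (ball x (Real.sqrt t))).toReal * (μ (ball y (Real.sqrt t))).toReal) := by
  have h1 : 0 < C₀⁻¹ * Real.exp (-b₀ * dist x y ^ 2 / t) := by positivity
  have h2 := lt_of_lt_of_le h1 (hlower t x y ht)
  constructor
  · exact pos_of_mul_pos_left h2 (Real.sqrt_nonneg _)
  · exact pos_of_mul_pos_right h2 (hHnonneg t x y ht)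

theorem ball_ne_top {μ : Measure M} {H : ℝ → M → M → ℝ}
    {C₀ b₀ : ℝ} (hC₀ : 0 < C₀)
    (hHnonneg : ∀ t x y, 0 < t → 0 ≤ H t x y)
    (hlower : ∀ t x y, 0 < t →
      C₀⁻¹ * Real.exp (-b₀ * dist x y ^ 2 / t) ≤
        H t x y *
          Real.sqrt
            ((μ (ball x (Real.sqrt t))).toReal * (μ (ball y (Real.sqrt t))).toReal))
    {r : ℝ} (hr : 0 < r) (x : M) : μ (ball x r) ≠ ⊤ := by
  intro htop
  have h := (ball_pos_of_lower hC₀ hHnonneg hlower (t := r ^ 2) (by positivity) x x).2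
  rw [Real.sqrt_sq hr.le, htop] at h
  simp at h

theorem sigmaFinite_of_ball {μ : Measure M} (h : ∀ (x : M) (r : ℝ), 0 < r → μ (ball x r) ≠ ⊤) :
    SigmaFinite μ := by
  rcases isEmpty_or_nonempty M with hM | ⟨⟨x⟩⟩
  · rw [Measure.eq_zero_of_isEmpty μ]; infer_instance
  · refine ⟨⟨⟨fun n => ball x (n + 1), fun _ => trivial, fun n => ?_, ?_⟩⟩⟩
    · exact (h x _ (by positivity)).lt_top
    · rw [eq_univ_iff_forall]
      intro y
      obtain ⟨n, hn⟩ := exists_nat_gt (dist y x)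
      exact mem_iUnion.2 ⟨n, by rw [mem_ball]; linarith⟩

theorem sg_concrete (μ : Measure M)
    (c₀ D : ℝ) (hc₀ : 0 < c₀) (hD : 0 < D)
    (hdoub : ∀ (x : M) (r R : ℝ), 0 < r → 1 ≤ R →
      μ (ball x (R * r)) ≤ ENNReal.ofReal (c₀ * R ^ D) * μ (ball x r))
    (H : ℝ → M → M → ℝ)
    (hHmeas : Measurable fun p : ℝ × M × M => H p.1 p.2.1 p.2.2)
    (hHnonneg : ∀ t x y, 0 < t → 0 ≤ H t x y)
    (hHsymm : ∀ t x y, 0 < t → H t x y = H t y x)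
    (hmarkov : ∀ t x, 0 < t → ∫⁻ y, ENNReal.ofReal (H t x y) ∂μ = 1)
    (hck : ∀ s t x y, 0 < s → 0 < t →
      ∫ z, H s x z * H t z y ∂μ = H (s + t) x y)
    (C₀ b₀ b₁ : ℝ) (hC₀ : 0 < C₀) (hb₀ : 0 < b₀) (hb₁ : 0 < b₁)
    (hlower : ∀ t x y, 0 < t →
      C₀⁻¹ * Real.exp (-b₀ * dist x y ^ 2 / t) ≤
        H t x y *
          Real.sqrt
            ((μ (ball x (Real.sqrt t))).toReal * (μ (ball y (Real.sqrt t))).toReal))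
    (hupper : ∀ t x y, 0 < t →
      H t x y *
          Real.sqrt
            ((μ (ball x (Real.sqrt t))).toReal * (μ (ball y (Real.sqrt t))).toReal) ≤
        C₀ * Real.exp (-b₁ * dist x y ^ 2 / t)) :
    SG μ (fun t x y => ENNReal.ofReal (H t x y)) where
  meas := hHmeas.ennreal_ofReal
  symm := fun t x y ht => by rw [hHsymm t x y ht]
  markov := hmarkov
  ck := by
    intro s t x y hs ht
    have hpos := (ball_pos_of_lower hC₀ hHnonneg hlower (add_pos hs ht) x y).1
    have hInteg : Integrable (fun z => H s x z * H t z y) μ := by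
      by_contra hni
      have := hck s t x y hs ht
      rw [integral_undef hni] at this
      linarith
    rw [← hck s t x y hs ht, ofReal_integral_eq_lintegral_ofReal hInteg
      (ae_of_all _ fun z => mul_nonneg (hHnonneg s x z hs) (hHnonneg t z y ht))]
    refine lintegral_congr fun z => ?_
    rw [ENNReal.ofReal_mul (hHnonneg s x z hs)]
  comp := by
    refine ⟨max 1 (b₀ / b₁), le_max_left _ _, fun L => ?_⟩
    set a := c₀ * (Real.sqrt L) ^ D with ha
    have ha0 : 0 ≤ a := by positivity
    refine ⟨ENNReal.ofReal (C₀ * (C₀ * a)), ENNReal.ofReal_ne_top, ?_⟩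
    intro t s ht hKs hsL x y
    have hts : t ≤ s := by
      have := le_max_left 1 (b₀ / b₁)
      nlinarith
    have hs : 0 < s := by linarith
    have hbs : b₀ * t ≤ b₁ * s := by
      have h1 : b₀ / b₁ * t ≤ s := le_trans (by gcongr; exact le_max_right _ _) hKs
      rw [div_mul_eq_mul_div, div_le_iff₀ hb₁] at h1
      linarith
    rw [← ENNReal.ofReal_mul (by positivity)]
    apply ENNReal.ofReal_le_ofReal
    have hV : ∀ z : M, (μ (ball z (Real.sqrt s))).toReal ≤ a * (μ (ball z (Real.sqrt t))).toReal := by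
      intro z
      have h1 : Real.sqrt s = Real.sqrt (s / t) * Real.sqrt t := by
        rw [← Real.sqrt_mul (by positivity), div_mul_cancel₀ _ ht.ne']
      have h2 := hdoub z (Real.sqrt t) (Real.sqrt (s / t)) (Real.sqrt_pos.2 ht)
        (Real.one_le_sqrt.2 ((one_le_div ht).2 hts))
      rw [← h1] at h2
      have hft : μ (ball z (Real.sqrt t)) ≠ ⊤ :=
        ball_ne_top hC₀ hHnonneg hlower (Real.sqrt_pos.2 ht) z
      have h3 := ENNReal.toReal_mono (ENNReal.mul_ne_top ENNReal.ofReal_ne_top hft) h2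
      rw [ENNReal.toReal_mul, ENNReal.toReal_ofReal (by positivity)] at h3
      refine h3.trans ?_
      rw [ha]
      gcongr
      rw [div_le_iff₀ ht]; exact hsL
    have hS := (ball_pos_of_lower hC₀ hHnonneg hlower ht x y).2
    set St := Real.sqrt
      ((μ (ball x (Real.sqrt t))).toReal * (μ (ball y (Real.sqrt t))).toReal) with hSt
    have hSs : Real.sqrt
        ((μ (ball x (Real.sqrt s))).toReal * (μ (ball y (Real.sqrt s))).toReal) ≤ a * St := by
      have h1 : a * St = Real.sqrt ((a * (μ (ball x (Real.sqrt t))).toReal) *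
          (a * (μ (ball y (Real.sqrt t))).toReal)) := by
        rw [show (a * (μ (ball x (Real.sqrt t))).toReal) *
          (a * (μ (ball y (Real.sqrt t))).toReal) = a ^ 2 * ((μ (ball x (Real.sqrt t))).toReal *
            (μ (ball y (Real.sqrt t))).toReal) by ring, Real.sqrt_mul (by positivity),
            Real.sqrt_sq ha0]
      rw [h1]
      apply Real.sqrt_le_sqrt
      gcongr
      · exact hV x
      · exact hV y
    have hexp : Real.exp (-b₁ * dist x y ^ 2 / t) ≤ Real.exp (-b₀ * dist x y ^ 2 / s) := by
      apply Real.exp_le_exp.2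
      rw [div_le_div_iff₀ ht hs]
      have : 0 ≤ dist x y ^ 2 := by positivity
      nlinarith
    have hl := hlower s x y hs
    rw [inv_mul_le_iff₀ hC₀] at hl
    refine le_of_mul_le_mul_right ?_ hS
    calc H t x y * St ≤ C₀ * Real.exp (-b₁ * dist x y ^ 2 / t) := hupper t x y ht
      _ ≤ C₀ * Real.exp (-b₀ * dist x y ^ 2 / s) := by gcongr
      _ ≤ C₀ * (C₀ * (H s x y * Real.sqrt
        ((μ (ball x (Real.sqrt s))).toReal * (μ (ball y (Real.sqrt s))).toReal))) := by gcongr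
      _ ≤ C₀ * (C₀ * (H s x y * (a * St))) := by
          have := hHnonneg s x y hs
          gcongr
      _ = C₀ * (C₀ * a) * H s x y * St := by ring

theorem Tt_le_kop {μ : Measure M} {H : ℝ → M → M → ℝ}
    (hHnonneg : ∀ t x y, 0 < t → 0 ≤ H t x y) {τ : ℝ} (hτ : 0 < τ) (A : ℝ) (g : M → ℝ) (x : M) :
    ENNReal.ofReal |A * Tt μ H τ g x| ≤
      kop μ (fun x y => ENNReal.ofReal (H τ x y)) (fun y => ENNReal.ofReal |A * g y|) x := by
  unfold Tt kop
  rw [if_neg hτ.ne', ← integral_const_mul, ← Real.enorm_eq_ofReal_abs]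
  refine (enorm_integral_le_lintegral_enorm _).trans_eq ?_
  refine lintegral_congr fun y => ?_
  rw [Real.enorm_eq_ofReal_abs, ← ENNReal.ofReal_mul (hHnonneg τ x y hτ)]
  congr 1
  rw [abs_mul, abs_mul, abs_mul, abs_of_nonneg (hHnonneg τ x y hτ)]
  ring

theorem Tt_measurable {μ : Measure M} [SFinite μ] {H : ℝ → M → M → ℝ}
    (hHmeas : Measurable fun p : ℝ × M × M => H p.1 p.2.1 p.2.2) (γ : ℝ) {f : M → ℝ}
    (hf : Measurable f) : Measurable (Function.uncurry fun t x => Tt μ H (γ * t) f x) := by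
  unfold Tt
  refine Measurable.ite ?_ (hf.comp measurable_snd) ?_
  · exact measurableSet_eq_fun (measurable_fst.const_mul γ) measurable_const
  · have h1 : Measurable fun z : (ℝ × M) × M => H (γ * z.1.1) z.1.2 z.2 * f z.2 := by
      refine Measurable.mul ?_ (hf.comp measurable_snd)
      exact hHmeas.comp (((measurable_fst.comp measurable_fst).const_mul γ).prodMk
        ((measurable_snd.comp measurable_fst).prodMk measurable_snd))
    exact h1.stronglyMeasurable.integral_prod_right'.measurable

theorem Tt_semigroup {μ : Measure M} [SFinite μ] {H : ℝ → M → M → ℝ}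
    (hHnonneg : ∀ t x y, 0 < t → 0 ≤ H t x y)
    (hsg : SG μ (fun t x y => ENNReal.ofReal (H t x y)))
    (hHmeas : Measurable fun p : ℝ × M × M => H p.1 p.2.1 p.2.2)
    (hck : ∀ s t x y, 0 < s → 0 < t →
      ∫ z, H s x z * H t z y ∂μ = H (s + t) x y)
    {a b : ℝ} (ha : 0 < a) (hb : 0 < b) {f : M → ℝ} (hf : Measurable f) (x : M)
    (hInteg : Integrable (fun y => H (a + b) x y * |f y|) μ) :
    Tt μ H (a + b) f x = Tt μ H a (Tt μ H b f) x := by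
  have hab : 0 < a + b := add_pos ha hb
  have hTb : ∀ z, Tt μ H b f z = ∫ y, H b z y * f y ∂μ := fun z => by
    unfold Tt; rw [if_neg hb.ne']
  have hTa : Tt μ H a (Tt μ H b f) x = ∫ z, H a x z * Tt μ H b f z ∂μ := by
    rw [Tt, if_neg ha.ne']
  rw [hTa, Tt, if_neg hab.ne']
  have e1 : ∀ y, H (a + b) x y * f y = ∫ z, H a x z * (H b z y * f y) ∂μ := by
    intro y
    rw [← hck a b x y ha hb, ← integral_mul_const]
    simp_rw [mul_assoc]
  have e2 : ∀ z, H a x z * Tt μ H b f z = ∫ y, H a x z * (H b z y * f y) ∂μ := by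
    intro z
    rw [hTb, integral_const_mul]
  simp_rw [e1, e2]
  apply integral_integral_swap
  have hm : Measurable (Function.uncurry fun (y z : M) => H a x z * (H b z y * f y)) := by
    refine Measurable.mul ?_ (Measurable.mul ?_ (hf.comp measurable_fst))
    · exact hHmeas.comp (measurable_const.prodMk (measurable_const.prodMk measurable_snd))
    · exact hHmeas.comp (measurable_const.prodMk (measurable_snd.prodMk measurable_fst))
  refine ⟨hm.aestronglyMeasurable, ?_⟩
  unfold HasFiniteIntegral
  rw [lintegral_prod_symm _ hm.enorm.aemeasurable]
  have hfm : Measurable fun y => ENNReal.ofReal |f y| :=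
    (continuous_abs.measurable.comp hf).ennreal_ofReal
  have h3 := hsg.kop_comp ha hb hfm x
  have h4 : ∫⁻ z, ∫⁻ y, ‖(Function.uncurry fun (y z : M) => H a x z * (H b z y * f y)) (y, z)‖ₑ ∂μ ∂μ
      = kop μ (fun x y => ENNReal.ofReal (H a x y)) (kop μ (fun x y => ENNReal.ofReal (H b x y))
        (fun y => ENNReal.ofReal |f y|)) x := by
    unfold kop
    refine lintegral_congr fun z => ?_
    rw [← lintegral_const_mul' _ _ ENNReal.ofReal_ne_top]
    refine lintegral_congr fun y => ?_
    simp only [Function.uncurry]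
    rw [Real.enorm_eq_ofReal_abs, ← ENNReal.ofReal_mul (hHnonneg b z y hb),
      ← ENNReal.ofReal_mul (hHnonneg a x z ha), abs_mul, abs_mul,
      abs_of_nonneg (hHnonneg a x z ha), abs_of_nonneg (hHnonneg b z y hb)]
  rw [h4, h3]
  have h5 : kop μ (fun x y => ENNReal.ofReal (H (a + b) x y)) (fun y => ENNReal.ofReal |f y|) x
      = ∫⁻ y, ‖H (a + b) x y * |f y|‖ₑ ∂μ := by
    unfold kop
    refine lintegral_congr fun y => ?_
    rw [Real.enorm_eq_ofReal_abs, ← ENNReal.ofReal_mul (hHnonneg _ x y hab), abs_mul,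
      abs_of_nonneg (hHnonneg _ x y hab), abs_abs]
  rw [h5]
  exact hInteg.2

theorem rpow_ratio_le {s t β : ℝ} (hs : 0 < s) (h1 : t / 2 < s) (h2 : s < t) :
    t ^ β ≤ 2 ^ |β| * s ^ β := by
  have ht : 0 < t := by linarith
  have hle : (t / s) ^ β ≤ 2 ^ |β| := by
    have h3 : 1 ≤ t / s := (one_le_div hs).2 h2.le
    calc (t / s) ^ β ≤ (t / s) ^ |β| := Real.rpow_le_rpow_of_exponent_le h3 (le_abs_self β)
      _ ≤ 2 ^ |β| := by
        apply Real.rpow_le_rpow (by positivity) _ (abs_nonneg β)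
        rw [div_le_iff₀ hs]; linarith
  rw [Real.div_rpow ht.le hs.le, div_le_iff₀ (by positivity)] at hle
  exact hle

end Concrete

/-- First part of Corollary `bilinearCRTNint` of the paper: for `p ∈ (1,∞)`, `q ∈ [1,∞]`,
`β ∈ ℝ`, `c > 0` and `γ ≥ 0` there is `C > 0` such that for measurable `f` with
`T_{γt}|f|(x) < ∞` one has
`‖t^β T_{ct}|T_{γt} f|‖_{L^p(L^q_+)} ≤ C ‖t^β T_{γt} f‖_{L^p(L^q_+)}` (with `T_0 f = f`). -/
theorem stmt_15 (μ : Measure M)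
    (c₀ D : ℝ) (hc₀ : 0 < c₀) (hD : 0 < D)
    (hdoub : ∀ (x : M) (r R : ℝ), 0 < r → 1 ≤ R →
      μ (ball x (R * r)) ≤ ENNReal.ofReal (c₀ * R ^ D) * μ (ball x r))
    (H : ℝ → M → M → ℝ)
    (hHmeas : Measurable fun p : ℝ × M × M => H p.1 p.2.1 p.2.2)
    (hHnonneg : ∀ t x y, 0 < t → 0 ≤ H t x y)
    (hHsymm : ∀ t x y, 0 < t → H t x y = H t y x)
    (hmarkov : ∀ t x, 0 < t → ∫⁻ y, ENNReal.ofReal (H t x y) ∂μ = 1)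
    (hck : ∀ s t x y, 0 < s → 0 < t →
      ∫ z, H s x z * H t z y ∂μ = H (s + t) x y)
    (C₀ b₀ b₁ : ℝ) (hC₀ : 0 < C₀) (hb₀ : 0 < b₀) (hb₁ : 0 < b₁)
    (hlower : ∀ t x y, 0 < t →
      C₀⁻¹ * Real.exp (-b₀ * dist x y ^ 2 / t) ≤
        H t x y *
          Real.sqrt
            ((μ (ball x (Real.sqrt t))).toReal * (μ (ball y (Real.sqrt t))).toReal))
    (hupper : ∀ t x y, 0 < t →
      H t x y *
          Real.sqrt
            ((μ (ball x (Real.sqrt t))).toReal * (μ (ball y (Real.sqrt t))).toReal) ≤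
        C₀ * Real.exp (-b₁ * dist x y ^ 2 / t))
    (p : ℝ) (hp1 : 1 < p) (q : ENNReal) (hq : 1 ≤ q) (β : ℝ) (c γ : ℝ) (hc : 0 < c)
    (hγ : 0 ≤ γ) :
    ∃ C : ℝ, 0 < C ∧
      ∀ f : M → ℝ, Measurable f →
        (∀ t x, 0 < t → 0 < γ → Integrable (fun y => H (γ * t) x y * |f y|) μ) →
        LpLqNorm μ p q
            (fun t x => t ^ β * Tt μ H (c * t) (fun y => |Tt μ H (γ * t) f y|) x) ≤
          ENNReal.ofReal C * LpLqNorm μ p q (fun t x => t ^ β * Tt μ H (γ * t) f x) := by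
  classical
  have hballs : ∀ (x : M) (r : ℝ), 0 < r → μ (ball x r) ≠ ⊤ := fun x r hr =>
    ball_ne_top hC₀ hHnonneg hlower hr x
  have : SigmaFinite μ := sigmaFinite_of_ball hballs
  have hsg := sg_concrete μ c₀ D hc₀ hD hdoub H hHmeas hHnonneg hHsymm hmarkov hck C₀ b₀ b₁
    hC₀ hb₀ hb₁ hlower hupper
  have hp0 : 0 < p := by linarith
  set k : ℝ → M → M → ENNReal := fun t x y => ENNReal.ofReal (H t x y) with hk
  -- it suffices to have a bound for the `p`-th powers with a finite constant
  suffices hmain : ∃ C : ENNReal, C ≠ ⊤ ∧ ∀ f : M → ℝ, Measurable f →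
      (∀ t x, 0 < t → 0 < γ → Integrable (fun y => H (γ * t) x y * |f y|) μ) →
      ∫⁻ x, qIntNorm q (fun t => ENNReal.ofReal
        |t ^ β * Tt μ H (c * t) (fun y => |Tt μ H (γ * t) f y|) x|) ^ p ∂μ ≤
      C * ∫⁻ x, qIntNorm q (fun t => ENNReal.ofReal |t ^ β * Tt μ H (γ * t) f x|) ^ p ∂μ by
    obtain ⟨C, hC, h⟩ := hmain
    have hC' : C ^ (1 / p) ≠ ⊤ := ENNReal.rpow_ne_top_of_nonneg (by positivity) hC
    refine ⟨(C ^ (1 / p)).toReal + 1, by positivity, fun f hf hInteg => ?_⟩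
    unfold LpLqNorm
    refine (ENNReal.rpow_le_rpow (h f hf hInteg) (by positivity)).trans ?_
    rw [ENNReal.mul_rpow_of_nonneg _ _ (by positivity)]
    gcongr
    rw [ENNReal.ofReal_add (by positivity) (by norm_num), ENNReal.ofReal_toReal hC']
    exact le_self_add
  have hum : ∀ f : M → ℝ, Measurable f → Measurable (Function.uncurry fun (t : ℝ) (y : M) =>
      ENNReal.ofReal |t ^ β * Tt μ H (γ * t) f y|) := by
    intro f hf
    have h1 : Measurable fun z : ℝ × M => z.1 ^ β := measurable_fst.pow_const β
    have h2 := h1.mul (Tt_measurable (μ := μ) hHmeas γ hf)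
    exact (continuous_abs.measurable.comp h2).ennreal_ofReal
  have hpt : ∀ (f : M → ℝ) (t : ℝ) (x : M), 0 < t →
      ENNReal.ofReal |t ^ β * Tt μ H (c * t) (fun y => |Tt μ H (γ * t) f y|) x| ≤
      kop μ (k (c * t)) (fun y => ENNReal.ofReal |t ^ β * Tt μ H (γ * t) f y|) x := by
    intro f t x ht
    refine (Tt_le_kop hHnonneg (mul_pos hc ht) _ _ x).trans_eq ?_
    simp only [abs_mul, abs_abs, hk]
  by_cases hqt : q = ⊤
  · subst hqt
    obtain ⟨C, hC, hmix⟩ := hsg.mixed_top hc hγ hp1 (B := ENNReal.ofReal (2 ^ |β|))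
      ENNReal.ofReal_ne_top
    refine ⟨C, hC, fun f hf hInteg => ?_⟩
    simp only [qIntNorm, if_true]
    refine le_trans ?_ (hmix _ (hum f hf) ?_)
    · refine lintegral_mono fun x => ENNReal.rpow_le_rpow ?_ hp0.le
      exact iSup₂_mono fun t ht => hpt f t x ht
    · intro s t hs hts hst y
      have ht : 0 < t := by linarith
      have hr := rpow_ratio_le (β := β) hs hts hst
      have hsb : 0 < s ^ β := by positivity
      have htb : 0 < t ^ β := by positivity
      split_ifs with h0
      · rw [← ENNReal.ofReal_mul (by positivity)]
        apply ENNReal.ofReal_le_ofReal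
        rw [h0, zero_mul, zero_mul, abs_mul, abs_mul, abs_of_pos hsb, abs_of_pos htb, ← mul_assoc]
        gcongr
      · have hγ0 : 0 < γ := lt_of_le_of_ne hγ (Ne.symm h0)
        have hts0 : 0 < γ * (t - s) := mul_pos hγ0 (by linarith)
        have hsum : γ * (t - s) + γ * s = γ * t := by ring
        have hsemi : Tt μ H (γ * t) f y = Tt μ H (γ * (t - s)) (Tt μ H (γ * s) f) y := by
          rw [← hsum]
          apply Tt_semigroup hHnonneg hsg hHmeas hck hts0 (mul_pos hγ0 hs) hf
          rw [hsum]
          exact hInteg t y ht hγ0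
        refine le_trans ?_ (mul_le_mul_right (Tt_le_kop hHnonneg hts0 (s ^ β)
          (Tt μ H (γ * s) f) y) _)
        rw [← hsemi, ← ENNReal.ofReal_mul (by positivity)]
        apply ENNReal.ofReal_le_ofReal
        rw [abs_mul, abs_mul, abs_of_pos hsb, abs_of_pos htb, ← mul_assoc]
        gcongr
  · have hq1 : 1 ≤ q.toReal := by
      have := ENNReal.toReal_mono hqt hq
      simpa using this
    have hq0 : 0 < q.toReal := by linarith
    obtain ⟨C, hC, hmix⟩ := hsg.mixed hc hp1 hq1
    refine ⟨C, hC, fun f hf hInteg => ?_⟩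
    simp only [qIntNorm, if_neg hqt]
    have hdm : Measurable fun t : ℝ => ENNReal.ofReal t⁻¹ := measurable_inv.ennreal_ofReal
    set ν := (volume.restrict (Ioi (0 : ℝ))).withDensity fun t => ENNReal.ofReal t⁻¹ with hν
    have hνpos : ∀ᵐ t ∂ν, 0 < t :=
      (withDensity_absolutelyContinuous _ _).ae_le (ae_restrict_mem measurableSet_Ioi)
    have hmix' := hmix ν hνpos _ (hum f hf)
    have hexp : ∀ Y : ENNReal, (Y ^ (1 / q.toReal)) ^ p = Y ^ (p / q.toReal) := by
      intro Y
      rw [← ENNReal.rpow_mul]; congr 1; ring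
    have hconv : ∀ G : ℝ → ENNReal, Measurable G →
        ∫⁻ t, G t ∂ν = ∫⁻ t in Ioi (0 : ℝ), G t * ENNReal.ofReal t⁻¹ := by
      intro G hG
      rw [hν, lintegral_withDensity_eq_lintegral_mul _ hdm hG]
      refine lintegral_congr fun t => ?_
      simp only [Pi.mul_apply]
      rw [mul_comm]
    simp_rw [hexp]
    refine le_trans ?_ (hmix'.trans_eq ?_)
    · refine lintegral_mono fun x => ENNReal.rpow_le_rpow ?_ (by positivity)
      rw [hconv]
      · refine setLIntegral_mono' measurableSet_Ioi fun t ht => ?_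
        gcongr
        exact hpt f t x ht
      · exact ((hsg.measurable_joint c (hum f hf)).comp
          (measurable_prodMk_right (y := x))).pow_const _
    · congr 1
      refine lintegral_congr fun x => ?_
      rw [hconv]
      exact ((hum f hf).comp (measurable_prodMk_right (y := x))).pow_const _
end

section
/- Let d ≥ 1 and for t > 0 define the heat kernel k_t(x) = (4πt)^{-d/2} exp(-|x|²/(4t)) on ℝ^d, and for φ in the Schwartz space S(ℝ^d) set T_t φ = k_t ⋆ φ (convolution). Let Δ denote the Euclidean Laplacian Δψ = Σ_{i=1}^d ∂²ψ/∂x_i². Then for every φ ∈ S(ℝ^d), every integer m ≥ 1, every τ > 0 and every x ∈ ℝ^d, the function t ↦ t^{m-1} ((-Δ)^m T_t φ)(x) is integrable on (0,τ] and φ(x) = (1/(m-1)!) ∫₀^τ t^{m-1} ((-Δ)^m T_t φ)(x) dt + Σ_{k=0}^{m-1} (τ^k / k!) ((-Δ)^k T_τ φ)(x). -/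
open MeasureTheory Real Set

/-- The Euclidean heat kernel `k_t(x) = (4πt)^(-d/2) exp(-|x|²/(4t))` on `ℝ^d`. -/
noncomputable def heatK (d : ℕ) (t : ℝ) (x : EuclideanSpace ℝ (Fin d)) : ℝ :=
  (4 * Real.pi * t) ^ (-(d : ℝ) / 2) * Real.exp (-‖x‖ ^ 2 / (4 * t))

/-- The heat semigroup `T_t φ = k_t ⋆ φ` on `ℝ^d`. -/
noncomputable def heatOp (d : ℕ) (t : ℝ) (φ : EuclideanSpace ℝ (Fin d) → ℝ) :
    EuclideanSpace ℝ (Fin d) → ℝ :=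
  fun x => ∫ y, heatK d t y * φ (x - y)

/-- The Euclidean Laplacian `Δf = ∑ᵢ ∂²f/∂xᵢ²`, via the second iterated derivative. -/
noncomputable def lap (d : ℕ) (f : EuclideanSpace ℝ (Fin d) → ℝ) :
    EuclideanSpace ℝ (Fin d) → ℝ :=
  fun x => ∑ i : Fin d,
    iteratedFDeriv ℝ 2 f x ![EuclideanSpace.single i 1, EuclideanSpace.single i 1]

/-- The `m`-fold iterate of minus the Laplacian, `(-Δ)^m`. -/
noncomputable def negLapIter (d m : ℕ) :
    (EuclideanSpace ℝ (Fin d) → ℝ) → EuclideanSpace ℝ (Fin d) → ℝ :=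
  (fun g x => -lap d g x)^[m]

section helpers
open scoped FourierTransform SchwartzMap Laplacian Topology RealInnerProductSpace

local notation "EE" d => EuclideanSpace ℝ (Fin d)

lemma heatK_eq_mul (d : ℕ) (t : ℝ) : heatK d t = fun x =>
    (4 * Real.pi * t) ^ (-(d : ℝ) / 2) * Real.exp (-(1 / (4 * t)) * ‖x‖ ^ 2) := by
  funext x
  unfold heatK
  congr 2
  ring

lemma heatK_cont (d : ℕ) (t : ℝ) : Continuous (heatK d t) := by
  rw [heatK_eq_mul]
  fun_prop

lemma heatK_integrable (d : ℕ) {t : ℝ} (ht : 0 < t) : Integrable (heatK d t) := by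
  rw [heatK_eq_mul]
  apply Integrable.const_mul
  have h : 0 < (((1 / (4 * t) : ℝ) : ℂ)).re := by
    rw [Complex.ofReal_re]; positivity
  have := (GaussianFourier.integrable_cexp_neg_mul_sq_norm_add (V := EE d) h 0 0).norm
  refine this.congr (Filter.Eventually.of_forall fun v => ?_)
  simp only [Complex.norm_exp]
  congr 1
  simp [← Complex.ofReal_pow]

section conv
variable {d : ℕ} {F : Type*} [NormedAddCommGroup F] [NormedSpace ℝ F] [CompleteSpace F]

lemma conv_integrable (f : 𝓢(EE d, F)) {k : (EE d) → ℝ} (hk : Continuous k) (hki : Integrable k)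
    (x : EE d) : Integrable (fun y => k y • f (x - y)) := by
  refine Integrable.mono' (g := fun y => ‖k y‖ * SchwartzMap.seminorm ℝ 0 0 f)
    (hki.norm.mul_const _) ?_ (Filter.Eventually.of_forall fun y => ?_)
  · have := f.continuous
    exact Continuous.aestronglyMeasurable (by fun_prop)
  · rw [norm_smul]
    gcongr
    exact SchwartzMap.norm_le_seminorm ℝ f _

lemma conv_hasFDerivAt (f : 𝓢(EE d, F)) {k : (EE d) → ℝ} (hk : Continuous k) (hki : Integrable k)
    (x : EE d) : HasFDerivAt (fun x => ∫ y, k y • f (x - y))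
      (∫ y, k y • SchwartzMap.fderivCLM ℝ (EE d) F f (x - y)) x := by
  refine hasFDerivAt_integral_of_dominated_of_fderiv_le (s := Set.univ)
    (bound := fun y => ‖k y‖ * SchwartzMap.seminorm ℝ 0 0 (SchwartzMap.fderivCLM ℝ (EE d) F f))
    (F' := fun x y => k y • SchwartzMap.fderivCLM ℝ (EE d) F f (x - y))
    Filter.univ_mem (Filter.Eventually.of_forall fun z => (conv_integrable f hk hki z).1)
    (conv_integrable f hk hki x) (conv_integrable _ hk hki x).1 ?_ (hki.norm.mul_const _) ?_
  · refine Filter.Eventually.of_forall fun y z _ => ?_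
    rw [norm_smul]
    gcongr
    exact SchwartzMap.norm_le_seminorm ℝ _ _
  · refine Filter.Eventually.of_forall fun y z _ => ?_
    have h1 := f.hasFDerivAt (z - y)
    have h2 := h1.comp z ((hasFDerivAt_id z).sub_const y)
    exact h2.const_smul (k y)

end conv

lemma lap_schwartz (d : ℕ) (ψ : 𝓢(EE d, ℝ)) (x : EE d) : lap d ψ x = (Δ ψ) x := by
  rw [SchwartzMap.laplacian_apply, InnerProductSpace.laplacian_eq_iteratedFDeriv_orthonormalBasis
    ψ (EuclideanSpace.basisFun (Fin d) ℝ)]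
  simp [lap]

lemma lap_heatOp (d : ℕ) {t : ℝ} (ht : 0 < t) (ψ : 𝓢(EE d, ℝ)) :
    (fun x => -lap d (heatOp d t ψ) x) = heatOp d t (-(Δ ψ) : 𝓢(EE d, ℝ)) := by
  have hk := heatK_cont d t
  have hki := heatK_integrable d ht
  funext x
  set D1 := SchwartzMap.fderivCLM ℝ (EE d) ℝ ψ with hD1
  set D2 := SchwartzMap.fderivCLM ℝ (EE d) _ D1 with hD2
  have e1 : fderiv ℝ (heatOp d t ψ) = fun x => ∫ y, heatK d t y • D1 (x - y) := by
    funext z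
    exact (conv_hasFDerivAt ψ hk hki z).fderiv
  have e2 : fderiv ℝ (fderiv ℝ (heatOp d t ψ)) x = ∫ y, heatK d t y • D2 (x - y) := by
    rw [e1]
    exact (conv_hasFDerivAt D1 hk hki x).fderiv
  have e3 : ∀ z, (Δ ψ) z = ∑ i : Fin d, D2 z (EuclideanSpace.single i 1) (EuclideanSpace.single i 1) := by
    intro z
    rw [← lap_schwartz]
    refine Finset.sum_congr rfl fun i _ => ?_
    rw [iteratedFDeriv_two_apply]
    rfl
  have hi := conv_integrable D2 hk hki x
  have e4 : ∀ v : EE d, Integrable (fun y => heatK d t y * D2 (x - y) v v) ∧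
      (∫ y, heatK d t y • D2 (x - y)) v v = ∫ y, heatK d t y * D2 (x - y) v v := by
    intro v
    have a1 := hi.apply_continuousLinearMap v
    have a2 := a1.apply_continuousLinearMap v
    refine ⟨a2, ?_⟩
    rw [ContinuousLinearMap.integral_apply hi, ContinuousLinearMap.integral_apply a1]
    rfl
  unfold lap
  simp only [iteratedFDeriv_two_apply, e2]
  unfold heatOp
  simp only [SchwartzMap.neg_apply, e3, mul_neg, integral_neg, Finset.mul_sum]
  rw [integral_finsetSum _ fun i _ => (e4 _).1]
  congr 1
  exact Finset.sum_congr rfl fun i _ => (e4 _).2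

/-- iterates of minus the Laplacian on Schwartz functions -/
noncomputable def nl (d : ℕ) (ψ : 𝓢(EE d, ℝ)) (k : ℕ) : 𝓢(EE d, ℝ) :=
  (fun g : 𝓢(EE d, ℝ) => -(Δ g))^[k] ψ

lemma nl_succ (d : ℕ) (ψ : 𝓢(EE d, ℝ)) (k : ℕ) : nl d ψ (k + 1) = -(Δ (nl d ψ k)) := by
  unfold nl
  rw [Function.iterate_succ_apply']

lemma negLapIter_heatOp (d : ℕ) {t : ℝ} (ht : 0 < t) (ψ : 𝓢(EE d, ℝ)) (k : ℕ) :
    negLapIter d k (heatOp d t ψ) = heatOp d t (nl d ψ k) := by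
  induction k with
  | zero => rfl
  | succ k ih =>
    unfold negLapIter at ih ⊢
    rw [Function.iterate_succ_apply', ih, lap_heatOp d ht, nl_succ]

/-- complexification -/
noncomputable def cx (d : ℕ) (ψ : 𝓢(EE d, ℝ)) : 𝓢(EE d, ℂ) := ψ.postcompCLM Complex.ofRealCLM

lemma cx_apply (d : ℕ) (ψ : 𝓢(EE d, ℝ)) (x : EE d) : cx d ψ x = (ψ x : ℂ) := rfl

lemma cx_lap (d : ℕ) (ψ : 𝓢(EE d, ℝ)) : cx d (-(Δ ψ)) = -(Δ (cx d ψ)) := by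
  ext x
  rw [cx_apply, SchwartzMap.neg_apply, SchwartzMap.neg_apply, SchwartzMap.laplacian_apply,
    SchwartzMap.laplacian_apply]
  have := ContDiffAt.laplacian_CLM_comp_left (l := Complex.ofRealCLM) (ψ.smooth 2).contDiffAt (x := x)
  have h2 : (⇑(cx d ψ) : (EE d) → ℂ) = Complex.ofRealCLM ∘ ψ := rfl
  rw [h2, this]
  simp

lemma fourier_cx (d : ℕ) (ψ : 𝓢(EE d, ℝ)) (ξ : EE d) :
    𝓕 (cx d (-(Δ ψ))) ξ = ((4 * π ^ 2 * ‖ξ‖ ^ 2 : ℝ) : ℂ) * 𝓕 (cx d ψ) ξ := by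
  rw [cx_lap, SchwartzMap.laplacian_eq_fourierMultiplierCLM, SchwartzMap.fourierMultiplierCLM_apply]
  have hT : (fun x : EE d => ‖x‖ ^ 2).HasTemperateGrowth := by fun_prop
  rw [neg_smul, neg_neg, FourierTransform.fourier_smul, FourierTransform.fourier_fourierInv_eq,
    SchwartzMap.smul_apply]
  have := SchwartzMap.smulLeftCLM_apply_apply hT (𝓕 (cx d ψ)) ξ
  erw [this]
  rw [smul_smul, Complex.real_smul]
  congr 2
  ring

/-- heat phase -/
noncomputable def ph (d : ℕ) (x : EE d) (t : ℝ) (ξ : EE d) : ℂ :=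
  Complex.exp (-(t * (4 * π ^ 2 * ‖ξ‖ ^ 2) : ℝ) + 2 * π * Complex.I * (⟪x, ξ⟫ : ℝ))

lemma ph_norm (d : ℕ) (x : EE d) {t : ℝ} (ht : 0 ≤ t) (ξ : EE d) : ‖ph d x t ξ‖ ≤ 1 := by
  unfold ph
  rw [Complex.norm_exp, Real.exp_le_one_iff]
  have : 0 ≤ t * (4 * π ^ 2 * ‖ξ‖ ^ 2) := by positivity
  simpa [-Complex.ofReal_mul] using this

lemma ph_cont (d : ℕ) (x : EE d) (t : ℝ) : Continuous (ph d x t) := by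
  unfold ph; fun_prop

lemma ph_cont_t (d : ℕ) (x ξ : EE d) : Continuous (fun t => ph d x t ξ) := by
  unfold ph; fun_prop

lemma ph_deriv (d : ℕ) (x ξ : EE d) (t : ℝ) :
    HasDerivAt (fun t => ph d x t ξ) (-(((4 * π ^ 2 * ‖ξ‖ ^ 2 : ℝ) : ℂ) * ph d x t ξ)) t := by
  unfold ph
  have h1 : HasDerivAt (fun t : ℝ => ((t * (4 * π ^ 2 * ‖ξ‖ ^ 2) : ℝ) : ℂ))
      ((1 * (4 * π ^ 2 * ‖ξ‖ ^ 2) : ℝ) : ℂ) t :=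
    ((hasDerivAt_id t).mul_const _).ofReal_comp
  refine (h1.neg.add_const (2 * π * Complex.I * (⟪x, ξ⟫ : ℝ))).cexp.congr_deriv ?_
  rw [one_mul, Pi.neg_apply]
  ring

noncomputable def uu (d : ℕ) (x : EE d) (ψ : 𝓢(EE d, ℝ)) (t : ℝ) : ℂ :=
  ∫ ξ, ph d x t ξ * 𝓕 (cx d ψ) ξ

lemma uu_integrable (d : ℕ) (x : EE d) (ψ : 𝓢(EE d, ℝ)) {t : ℝ} (ht : 0 ≤ t) :
    Integrable fun ξ => ph d x t ξ * 𝓕 (cx d ψ) ξ := by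
  refine (𝓕 (cx d ψ)).integrable.bdd_mul (c := 1) (ph_cont d x t).aestronglyMeasurable
    (Filter.Eventually.of_forall fun ξ => ph_norm d x ht ξ)

lemma uu_cont (d : ℕ) (x : EE d) (ψ : 𝓢(EE d, ℝ)) : ContinuousOn (uu d x ψ) (Ici 0) := by
  unfold uu
  refine continuousOn_of_dominated (bound := fun ξ => ‖𝓕 (cx d ψ) ξ‖)
    (fun t ht => (uu_integrable d x ψ ht).1) (fun t ht => Filter.Eventually.of_forall fun ξ => ?_)
    (𝓕 (cx d ψ)).integrable.norm (Filter.Eventually.of_forall fun ξ => ?_)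
  · rw [norm_mul]
    exact mul_le_of_le_one_left (norm_nonneg _) (ph_norm d x ht ξ)
  · exact ((ph_cont_t d x ξ).mul continuous_const).continuousOn

lemma uu_deriv (d : ℕ) (x : EE d) (ψ : 𝓢(EE d, ℝ)) {t : ℝ} (ht : 0 < t) :
    HasDerivAt (uu d x ψ) (-uu d x (-(Δ ψ)) t) t := by
  have := (hasDerivAt_integral_of_dominated_loc_of_deriv_le (μ := volume) (𝕜 := ℝ) (x₀ := t)
    (F := fun t ξ => ph d x t ξ * 𝓕 (cx d ψ) ξ)
    (F' := fun t ξ => -(ph d x t ξ * 𝓕 (cx d (-(Δ ψ))) ξ))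
    (bound := fun ξ => ‖𝓕 (cx d (-(Δ ψ))) ξ‖) (Ioi_mem_nhds ht)
    (by filter_upwards [Ioi_mem_nhds ht] with s hs using (uu_integrable d x ψ (le_of_lt hs)).1)
    (uu_integrable d x ψ ht.le) (uu_integrable d x _ ht.le).neg.1
    (Filter.Eventually.of_forall fun ξ s hs => ?_) (𝓕 (cx d (-(Δ ψ)))).integrable.norm
    (Filter.Eventually.of_forall fun ξ s hs => ?_)).2
  · rw [integral_neg] at this
    exact this
  · rw [norm_neg, norm_mul]
    exact mul_le_of_le_one_left (norm_nonneg _) (ph_norm d x (le_of_lt hs) ξ)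
  · refine ((ph_deriv d x ξ s).mul_const (𝓕 (cx d ψ) ξ)).congr_deriv ?_
    rw [fourier_cx]
    ring

lemma uu_zero (d : ℕ) (x : EE d) (ψ : 𝓢(EE d, ℝ)) : uu d x ψ 0 = ψ x := by
  have h : (𝓕⁻ (𝓕 (cx d ψ)) : 𝓢(EE d, ℂ)) = cx d ψ := FourierTransform.fourierInv_fourier_eq _
  rw [← cx_apply]
  conv_rhs => rw [← h, SchwartzMap.fourierInv_coe, Real.fourierInv_eq']
  unfold uu ph
  congr 1
  funext ξ
  rw [smul_eq_mul, real_inner_comm]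
  congr 2
  push_cast
  ring

lemma uu_pos (d : ℕ) (x : EE d) (ψ : 𝓢(EE d, ℝ)) {t : ℝ} (ht : 0 < t) :
    uu d x ψ t = (heatOp d t ψ x : ℝ) := by
  have hb : 0 < ((4 * π ^ 2 * t : ℝ) : ℂ).re := by rw [Complex.ofReal_re]; positivity
  have hph : ph d x t = fun ξ => Complex.exp (-((4 * π ^ 2 * t : ℝ) : ℂ) * ‖ξ‖ ^ 2 +
      2 * π * Complex.I * (⟪x, ξ⟫ : ℝ)) := by
    funext ξ
    unfold ph
    congr 2
    push_cast
    ring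
  have J : Integrable (ph d x t) := by
    rw [hph]
    exact GaussianFourier.integrable_cexp_neg_mul_sq_norm_add hb _ _
  have key : ∫ w, 𝓕 (ph d x t) w • cx d ψ w = ∫ w, ph d x t w • 𝓕 (⇑(cx d ψ)) w := by
    simpa using! (VectorFourier.integral_fourierIntegral_smul_eq_flip (L := innerₗ (EE d))
      Real.continuous_fourierChar continuous_inner J (cx d ψ).integrable)
  have hF : ∀ w, 𝓕 (ph d x t) w = (heatK d t (x - w) : ℝ) := by
    intro w
    rw [hph, fourier_gaussian_innerProductSpace' hb]
    unfold heatK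
    rw [Complex.ofReal_mul (_ ^ _), Complex.ofReal_exp, Complex.ofReal_cpow (by positivity)]
    congr 1
    · rw [finrank_euclideanSpace_fin]
      have : (π : ℂ) / ((4 * π ^ 2 * t : ℝ) : ℂ) = (((4 * π * t)⁻¹ : ℝ) : ℂ) := by
        rw [← Complex.ofReal_div]
        congr 1
        field_simp
      rw [this, Complex.ofReal_inv, Complex.inv_cpow, ← Complex.cpow_neg]
      · congr 1
        push_cast
        ring
      · rw [Complex.arg_ofReal_of_nonneg (by positivity)]
        exact pi_pos.ne
    · congr 1
      rw [← Complex.ofReal_pow, ← Complex.ofReal_pow, ← Complex.ofReal_neg, ← Complex.ofReal_mul, 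
        ← Complex.ofReal_div]
      congr 1
      field_simp
  unfold uu heatOp
  have : ∫ ξ, ph d x t ξ * 𝓕 (cx d ψ) ξ = ∫ w, ph d x t w • 𝓕 (⇑(cx d ψ)) w := rfl
  rw [this, ← key, ← integral_complex_ofReal, ← integral_sub_left_eq_self _ volume x]
  congr 1
  funext w
  rw [hF, cx_apply, sub_sub_cancel, smul_eq_mul, Complex.ofReal_mul]

/-- the real-valued version -/
noncomputable def ur (d : ℕ) (x : EE d) (φ : 𝓢(EE d, ℝ)) (k : ℕ) (t : ℝ) : ℝ :=
  (uu d x (nl d φ k) t).re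

lemma ur_cont (d : ℕ) (x : EE d) (φ : 𝓢(EE d, ℝ)) (k : ℕ) : ContinuousOn (ur d x φ k) (Ici 0) :=
  Complex.continuous_re.comp_continuousOn (uu_cont d x _)

lemma ur_deriv (d : ℕ) (x : EE d) (φ : 𝓢(EE d, ℝ)) (k : ℕ) {t : ℝ} (ht : 0 < t) :
    HasDerivAt (ur d x φ k) (-ur d x φ (k + 1) t) t := by
  have h := Complex.reCLM.hasFDerivAt.comp_hasDerivAt t (uu_deriv d x (nl d φ k) ht)
  unfold ur
  rw [nl_succ]
  simpa using! h

lemma ur_pos (d : ℕ) (x : EE d) (φ : 𝓢(EE d, ℝ)) (k : ℕ) {t : ℝ} (ht : 0 < t) :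
    negLapIter d k (heatOp d t φ) x = ur d x φ k t := by
  rw [negLapIter_heatOp d ht]
  unfold ur
  rw [uu_pos d x _ ht, Complex.ofReal_re]

lemma taylor_deriv (u : ℕ → ℝ → ℝ) (t : ℝ) (h : ∀ k, HasDerivAt (u k) (-u (k + 1) t) t) (n : ℕ) :
    HasDerivAt (fun s => ∑ k ∈ Finset.range (n + 1), s ^ k / (Nat.factorial k : ℝ) * u k s)
      (-(1 / (Nat.factorial n : ℝ) * (t ^ n * u (n + 1) t))) t := by
  induction n with
  | zero => simpa using h 0
  | succ n ih =>
    have h2 := (((hasDerivAt_pow (n + 1) t).div_const ((n + 1).factorial : ℝ))).mul (h (n + 1))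
    have h3 := ih.add h2
    refine (h3.congr_deriv ?_).congr_of_eventuallyEq (Filter.Eventually.of_forall fun s => ?_)
    · have : (n.factorial : ℝ) ≠ 0 := by positivity
      rw [Nat.factorial_succ]
      push_cast
      field_simp
      simp
    · simp [Finset.sum_range_succ _ (n + 1)]

end helpers

/-- Euclidean Calderón-type reproducing formula with inhomogeneous remainder terms: for
every Schwartz function `φ`, `m ≥ 1`, `τ > 0` and `x ∈ ℝ^d`, the function
`t ↦ t^(m-1) ((-Δ)^m T_t φ)(x)` is integrable on `(0,τ]` and
`φ(x) = (1/(m-1)!) ∫₀^τ t^(m-1) ((-Δ)^m T_t φ)(x) dt + ∑_{k<m} (τ^k/k!) ((-Δ)^k T_τ φ)(x)`. -/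
theorem stmt_18 (d : ℕ) (hd : 1 ≤ d) (φ : SchwartzMap (EuclideanSpace ℝ (Fin d)) ℝ)
    (m : ℕ) (hm : 1 ≤ m) (τ : ℝ) (hτ : 0 < τ) (x : EuclideanSpace ℝ (Fin d)) :
    IntegrableOn
        (fun t => t ^ (m - 1) * negLapIter d m (heatOp d t (fun y => φ y)) x)
        (Ioc 0 τ) ∧
      φ x =
        (1 / (Nat.factorial (m - 1) : ℝ)) *
            (∫ t in Ioc (0 : ℝ) τ,
              t ^ (m - 1) * negLapIter d m (heatOp d t (fun y => φ y)) x) +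
          ∑ k ∈ Finset.range m,
            τ ^ k / (Nat.factorial k : ℝ) * negLapIter d k (heatOp d τ (fun y => φ y)) x := by
  obtain ⟨n, rfl⟩ : ∃ n, m = n + 1 := ⟨m - 1, by omega⟩
  simp only [Nat.add_sub_cancel]
  have hcont : ∀ k, ContinuousOn (ur d x φ k) (Icc 0 τ) := fun k =>
    (ur_cont d x φ k).mono Icc_subset_Ici_self
  have heq : ∀ t ∈ Ioc (0 : ℝ) τ, t ^ n * ur d x φ (n + 1) t =
      t ^ n * negLapIter d (n + 1) (heatOp d t (fun y => φ y)) x := fun t ht => by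
    rw [← ur_pos d x φ (n + 1) ht.1]
  have hint : IntegrableOn (fun t => t ^ n * ur d x φ (n + 1) t) (Ioc 0 τ) :=
    (((continuous_pow n).continuousOn.mul (hcont (n + 1))).integrableOn_Icc).mono_set
      Ioc_subset_Icc_self
  refine ⟨hint.congr_fun heq measurableSet_Ioc, ?_⟩
  rw [← setIntegral_congr_fun measurableSet_Ioc heq]
  have hF := intervalIntegral.integral_eq_sub_of_hasDerivAt_of_le (a := 0) (b := τ)
    (f := fun s => ∑ k ∈ Finset.range (n + 1), s ^ k / (Nat.factorial k : ℝ) * ur d x φ k s)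
    (f' := fun t => -(1 / (Nat.factorial n : ℝ) * (t ^ n * ur d x φ (n + 1) t))) hτ.le
    (continuousOn_finset_sum _ fun k _ =>
      ((continuous_pow k).div_const _).continuousOn.mul (hcont k))
    (fun t ht => taylor_deriv _ t (fun k => ur_deriv d x φ k ht.1) n)
    (by
      rw [intervalIntegrable_iff_integrableOn_Ioc_of_le hτ.le]
      exact (hint.const_mul _).neg)
  rw [intervalIntegral.integral_neg, intervalIntegral.integral_const_mul,
    intervalIntegral.integral_of_le hτ.le] at hF
  have h0 : ∑ k ∈ Finset.range (n + 1), (0 : ℝ) ^ k / (Nat.factorial k : ℝ) * ur d x φ k 0 = φ x := by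
    rw [Finset.sum_range_succ']
    simp [ur, nl, uu_zero]
  rw [h0] at hF
  have h1 : ∑ k ∈ Finset.range (n + 1),
      τ ^ k / (Nat.factorial k : ℝ) * negLapIter d k (heatOp d τ (fun y => φ y)) x =
      ∑ k ∈ Finset.range (n + 1), τ ^ k / (Nat.factorial k : ℝ) * ur d x φ k τ :=
    Finset.sum_congr rfl fun k _ => by rw [← ur_pos d x φ k hτ]
  rw [h1]
  linarith
end
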